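/- arXiv:2505.07074 — 2 statements merged into one kernel-verified Lean document; each statement's English description precedes it below -/
import Mathlib

section
/- Let p and q be coprime positive integers with q ≥ 3p. Then every mass μ on ℝ² admits a (q,p)-spiral equicovering. -/
open MeasureTheory

noncomputable section

/-- An affine line in the plane. -/
def IsAffineLine (L : Set (ℝ × ℝ)) : Prop :=
  ∃ a b : ℝ × ℝ, b ≠ 0 ∧ L = {x | ∃ t : ℝ, x = a + t • b}

/-- A mass: a Borel probability measure on the plane giving measure zero to every line. -/
def IsMass (μ : Measure (ℝ × ℝ)) : Prop :=
  IsProbabilityMeasure μ ∧ ∀ L : Set (ℝ × ℝ), IsAffineLine L → μ L = 0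

/-- The wedge with apex `O` spanned by angles in `[α, β]`. -/
def Wedge (O : ℝ × ℝ) (α β : ℝ) : Set (ℝ × ℝ) :=
  {O} ∪ {x | ∃ r : ℝ, 0 < r ∧ ∃ θ ∈ Set.Icc α β, x = O + r • (Real.cos θ, Real.sin θ)}

/-- A `(q,p)`-spiral equicovering of the measure `μ`: a point `O` and a weakly increasing
sequence of angles `θ : ℤ → ℝ` with `θ (j+q) = θ j + 2π`, such that every `p`-wedge
`W(O, θ i, θ (i+p))` is convex and has `μ`-measure `p/q`. -/
def IsSpiralEquicovering (μ : Measure (ℝ × ℝ)) (q p : ℕ) : Prop :=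
  ∃ (O : ℝ × ℝ) (θ : ℤ → ℝ),
    (∀ j : ℤ, θ (j + (q : ℤ)) = θ j + 2 * Real.pi) ∧
    (∀ j : ℤ, θ j ≤ θ (j + 1)) ∧
    (∀ i : ℤ, Convex ℝ (Wedge O (θ i) (θ (i + (p : ℤ)))) ∧
      μ (Wedge O (θ i) (θ (i + (p : ℤ)))) = ENNReal.ofReal ((p : ℝ) / (q : ℝ)))

theorem exists_centerpoint {E : Type*} [NormedAddCommGroup E] [NormedSpace ℝ E]
    [FiniteDimensional ℝ E] [MeasurableSpace E] [BorelSpace E] (μ : Measure E)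
    [IsProbabilityMeasure μ] :
    ∃ O : E, ∀ f : E →L[ℝ] ℝ,
      1 / ((Module.finrank ℝ E : ℝ) + 1) ≤ μ.real {x | f O ≤ f x} := by
  set d : ℝ := (Module.finrank ℝ E : ℝ) + 1 with hd
  have hd0 : 0 < d := by positivity
  let F : {K : Set E // Convex ℝ K ∧ IsCompact K ∧ 1 - 1 / d < μ.real K} → Set E := fun K => K.1
  have hF : (⋂ i, F i).Nonempty := by
    refine Convex.helly_theorem_compact' (𝕜 := ℝ) (fun K => K.2.1) (fun K => K.2.2.1) ?_
    intro I hI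
    by_contra hne
    rw [Set.not_nonempty_iff_eq_empty] at hne
    have hcov : (⋃ i ∈ I, (F i)ᶜ) = Set.univ := by
      rw [← Set.compl_iInter₂, hne, Set.compl_empty]
    have hle := measureReal_biUnion_finset_le (μ := μ) I (fun i => (F i)ᶜ)
    rw [hcov, probReal_univ] at hle
    have hsmall : ∀ i ∈ I, μ.real (F i)ᶜ < 1 / d := fun i _ => by
      rw [probReal_compl_eq_one_sub i.2.2.1.measurableSet]
      have := i.2.2.2
      change 1 - μ.real i.1 < _
      linarith
    rcases I.eq_empty_or_nonempty with rfl | hIne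
    · norm_num at hle
    · have h1 := Finset.sum_lt_sum_of_nonempty hIne hsmall
      rw [Finset.sum_const, nsmul_eq_mul] at h1
      have h2 : (I.card : ℝ) ≤ d := by simpa [hd] using (Nat.cast_le (α := ℝ)).2 hI
      have h3 : (I.card : ℝ) * (1 / d) ≤ 1 := by
        rw [mul_one_div, div_le_one hd0]; exact h2
      linarith
  obtain ⟨O, hO⟩ := hF
  refine ⟨O, fun f => ?_⟩
  by_contra! hlt
  let K : ℕ → Set E := fun n => Metric.closedBall 0 n ∩ {x | f x ≤ f O - 1 / ((n : ℝ) + 1)}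
  have hKmono : Monotone K := by
    intro m n hmn x hx
    have hmn' : (m : ℝ) ≤ n := by exact_mod_cast hmn
    refine ⟨Metric.closedBall_subset_closedBall hmn' hx.1, ?_⟩
    have h1 : f x ≤ f O - 1 / ((m : ℝ) + 1) := hx.2
    have h2 : 1 / ((n : ℝ) + 1) ≤ 1 / ((m : ℝ) + 1) := by gcongr
    change f x ≤ f O - 1 / ((n : ℝ) + 1)
    linarith
  have hKunion : ⋃ n, K n = {x | f O ≤ f x}ᶜ := by
    ext x
    simp only [Set.mem_iUnion, Set.mem_compl_iff, Set.mem_ofPred_eq, not_le]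
    constructor
    · rintro ⟨n, -, hn⟩
      have h1 : f x ≤ f O - 1 / ((n : ℝ) + 1) := hn
      have : 0 < 1 / ((n : ℝ) + 1) := by positivity
      linarith
    · intro hx
      obtain ⟨m, hm⟩ := exists_nat_one_div_lt (sub_pos.2 hx)
      obtain ⟨k, hk⟩ := exists_nat_ge ‖x‖
      refine ⟨max m k, mem_closedBall_zero_iff.2 (hk.trans (by simp)), ?_⟩
      have h2 : 1 / (((max m k : ℕ) : ℝ) + 1) ≤ 1 / ((m : ℝ) + 1) := by
        gcongr
        exact le_max_left m k
      change f x ≤ f O - 1 / (((max m k : ℕ) : ℝ) + 1)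
      linarith
  have htend := tendsto_measure_iUnion_atTop (μ := μ) hKmono
  have htend' := (ENNReal.tendsto_toReal (measure_ne_top μ _)).comp htend
  rw [hKunion] at htend'
  have hclosed : IsClosed {x | f O ≤ f x} := isClosed_le continuous_const f.continuous
  have hbig : 1 - 1 / d < (μ {x | f O ≤ f x}ᶜ).toReal := by
    change _ < μ.real _
    rw [probReal_compl_eq_one_sub hclosed.measurableSet]
    linarith
  obtain ⟨n, hn⟩ := (htend'.eventually (lt_mem_nhds hbig)).exists
  have hKn : O ∈ K n := by
    refine Set.mem_iInter.1 hO ⟨K n, ?_, ?_, hn⟩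
    · exact (convex_closedBall 0 _).inter (convex_halfSpace_le f.isLinear _)
    · have := FiniteDimensional.proper_real E
      exact (isCompact_closedBall 0 _).inter_right (isClosed_le f.continuous continuous_const)
  have h1 : f O ≤ f O - 1 / ((n : ℝ) + 1) := hKn.2
  have : 0 < 1 / ((n : ℝ) + 1) := by positivity
  linarith

theorem mem_wedge_iff {O x : ℝ × ℝ} {α β : ℝ} (h : α ≤ β) :
    x ∈ Wedge O α β ↔
      ∃ r : ℝ, 0 ≤ r ∧ ∃ θ ∈ Set.Icc α β, x = O + r • (Real.cos θ, Real.sin θ) := by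
  constructor
  · rintro (hx | ⟨r, hr, hθ⟩)
    · exact ⟨0, le_rfl, α, Set.left_mem_Icc.2 h, by simpa using hx⟩
    · exact ⟨r, hr.le, hθ⟩
  · rintro ⟨r, hr, θ, hθ, hx⟩
    rcases hr.eq_or_lt with rfl | hr
    · exact Or.inl (by simpa using hx)
    · exact Or.inr ⟨r, hr, θ, hθ, hx⟩

theorem exists_polar_add_of_le {s t θ₁ θ₂ : ℝ} (hs : 0 ≤ s) (ht : 0 ≤ t) (h : θ₁ ≤ θ₂)
    (hπ : θ₂ - θ₁ ≤ Real.pi) :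
    ∃ r : ℝ, 0 ≤ r ∧ ∃ θ ∈ Set.Icc θ₁ θ₂,
      s • (Real.cos θ₁, Real.sin θ₁) + t • (Real.cos θ₂, Real.sin θ₂) =
        r • (Real.cos θ, Real.sin θ) := by
  rcases hπ.eq_or_lt with hπ | hπ
  · obtain rfl : θ₂ = θ₁ + Real.pi := by linarith
    rcases le_total s t with hst | hst
    · refine ⟨t - s, sub_nonneg.2 hst, θ₁ + Real.pi, Set.right_mem_Icc.2 h, ?_⟩
      ext <;> simp [Real.cos_add_pi, Real.sin_add_pi] <;> ring
    · refine ⟨s - t, sub_nonneg.2 hst, θ₁, Set.left_mem_Icc.2 h, ?_⟩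
      ext <;> simp [Real.cos_add_pi, Real.sin_add_pi] <;> ring
  have hcont : ContinuousOn (fun θ => t * Real.sin (θ₂ - θ) - s * Real.sin (θ - θ₁))
      (Set.Icc θ₁ θ₂) := by fun_prop
  have hsin : 0 ≤ Real.sin (θ₂ - θ₁) := Real.sin_nonneg_of_nonneg_of_le_pi (by linarith) hπ.le
  obtain ⟨θ, hθ, h0⟩ := intermediate_value_Icc' h hcont (show (0 : ℝ) ∈ _ by
    simp only [sub_self, Real.sin_zero, mul_zero, zero_sub, sub_zero]
    exact ⟨neg_nonpos.2 (mul_nonneg hs hsin), mul_nonneg ht hsin⟩)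
  obtain ⟨a, rfl⟩ : ∃ a, θ₁ = θ - a := ⟨θ - θ₁, by ring⟩
  obtain ⟨b, rfl⟩ : ∃ b, θ₂ = θ + b := ⟨θ₂ - θ, by ring⟩
  have ha : 0 ≤ a := by linarith [hθ.1]
  have hb : 0 ≤ b := by linarith [hθ.2]
  have h0 : t * Real.sin b = s * Real.sin a := by
    have : t * Real.sin (θ + b - θ) - s * Real.sin (θ - (θ - a)) = 0 := h0
    rw [show θ + b - θ = b by ring, show θ - (θ - a) = a by ring] at this
    linarith
  have hab : 0 ≤ Real.sin (a + b) :=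
    Real.sin_nonneg_of_nonneg_of_le_pi (by linarith) (by linarith)
  rw [Real.sin_add] at hab
  refine ⟨s * Real.cos a + t * Real.cos b, ?_, θ, hθ, ?_⟩
  · rcases ha.eq_or_lt with rfl | ha
    · rcases hb.eq_or_lt with rfl | hb
      · simpa using add_nonneg hs ht
      · have hsb := Real.sin_pos_of_pos_of_lt_pi hb (by linarith)
        have : t = 0 := by simpa [hsb.ne'] using h0
        simpa [this] using hs
    · have hsa := Real.sin_pos_of_pos_of_lt_pi ha (by linarith)
      refine nonneg_of_mul_nonneg_left (b := Real.sin a) ?_ hsa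
      have : (s * Real.cos a + t * Real.cos b) * Real.sin a =
          t * (Real.sin a * Real.cos b + Real.cos a * Real.sin b) := by
        linear_combination (-Real.cos a) * h0
      rw [this]
      exact mul_nonneg ht hab
  · ext
    · simp only [Prod.smul_mk, smul_eq_mul, Prod.mk_add_mk, Real.cos_sub, Real.cos_add]
      linear_combination (-Real.sin θ) * h0
    · simp only [Prod.smul_mk, smul_eq_mul, Prod.mk_add_mk, Real.sin_sub, Real.sin_add]
      linear_combination (Real.cos θ) * h0

theorem convex_wedge {O : ℝ × ℝ} {α β : ℝ} (h : α ≤ β) (hπ : β - α ≤ Real.pi) :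
    Convex ℝ (Wedge O α β) := by
  intro x hx y hy a b ha hb hab
  rw [mem_wedge_iff h] at hx hy ⊢
  obtain ⟨r, hr, θ, hθ, rfl⟩ := hx
  obtain ⟨s, hs, φ, hφ, rfl⟩ := hy
  suffices H : ∃ ρ : ℝ, 0 ≤ ρ ∧ ∃ ψ ∈ Set.Icc α β,
      (a * r) • (Real.cos θ, Real.sin θ) + (b * s) • (Real.cos φ, Real.sin φ) =
        ρ • (Real.cos ψ, Real.sin ψ) by
    obtain ⟨ρ, hρ, ψ, hψ, e⟩ := H
    refine ⟨ρ, hρ, ψ, hψ, ?_⟩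
    rw [← e, smul_add, smul_add, smul_smul, smul_smul, add_add_add_comm, ← add_smul, hab, one_smul]
  rcases le_total θ φ with hle | hle
  · obtain ⟨ρ, hρ, ψ, hψ, e⟩ := exists_polar_add_of_le (mul_nonneg ha hr) (mul_nonneg hb hs) hle
      (by linarith [hθ.1, hφ.2])
    exact ⟨ρ, hρ, ψ, ⟨hθ.1.trans hψ.1, hψ.2.trans hφ.2⟩, e⟩
  · obtain ⟨ρ, hρ, ψ, hψ, e⟩ := exists_polar_add_of_le (mul_nonneg hb hs) (mul_nonneg ha hr) hle
      (by linarith [hφ.1, hθ.2])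
    exact ⟨ρ, hρ, ψ, ⟨hφ.1.trans hψ.1, hψ.2.trans hθ.2⟩, by rw [add_comm, e]⟩

/-- The polar angle, in `(-π, π]`, of `x` seen from `O`. -/
def polarAngle (O x : ℝ × ℝ) : ℝ := Complex.arg ⟨x.1 - O.1, x.2 - O.2⟩

theorem measurable_polarAngle (O : ℝ × ℝ) : Measurable (polarAngle O) := by
  have : Continuous fun x : ℝ × ℝ => Complex.equivRealProdCLM.symm (x - O) := by fun_prop
  exact Complex.measurable_arg.comp this.measurable

theorem exists_eq_add_polarAngle (O x : ℝ × ℝ) :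
    ∃ r : ℝ, 0 ≤ r ∧ ∀ k : ℤ, x = O + r • (Real.cos (polarAngle O x + k * (2 * Real.pi)),
      Real.sin (polarAngle O x + k * (2 * Real.pi))) := by
  refine ⟨‖(⟨x.1 - O.1, x.2 - O.2⟩ : ℂ)‖, norm_nonneg _, fun k => ?_⟩
  rw [Real.cos_add_int_mul_two_pi, Real.sin_add_int_mul_two_pi]
  ext
  · simp [polarAngle, Complex.norm_mul_cos_arg]
  · simp [polarAngle, Complex.norm_mul_sin_arg]

theorem exists_eq_polarAngle_add (O : ℝ × ℝ) {r θ : ℝ} (hr : 0 < r) :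
    ∃ k : ℤ, θ = polarAngle O (O + r • (Real.cos θ, Real.sin θ)) + k * (2 * Real.pi) := by
  have h : (polarAngle O (O + r • (Real.cos θ, Real.sin θ)) : Real.Angle) = θ := by
    rw [polarAngle, ← Complex.arg_mul_cos_add_sin_mul_I_coe_angle hr (θ : Real.Angle)]
    congr 2
    apply Complex.ext <;> simp [Complex.cos_ofReal_re, Complex.sin_ofReal_re]
  obtain ⟨k, hk⟩ := Real.Angle.angle_eq_iff_two_pi_dvd_sub.1 h.symm
  exact ⟨k, by linarith⟩

/-- The line through `O` in direction `θ`. -/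
def lineThrough (O : ℝ × ℝ) (θ : ℝ) : Set (ℝ × ℝ) :=
  {x | ∃ t : ℝ, x = O + t • (Real.cos θ, Real.sin θ)}

theorem isAffineLine_lineThrough (O : ℝ × ℝ) (θ : ℝ) : IsAffineLine (lineThrough O θ) := by
  refine ⟨O, (Real.cos θ, Real.sin θ), fun h => ?_, rfl⟩
  obtain ⟨hc, hs⟩ := Prod.mk.inj h
  simpa [hc, hs] using Real.sin_sq_add_cos_sq θ

/-- Counts, with sign and up to a normalisation depending only on `x`, how often a ray from `O`
rotating to the angle `t` passes through `x`. -/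
def sweepCount (O : ℝ × ℝ) (t : ℝ) (x : ℝ × ℝ) : ℝ :=
  (⌊(t - polarAngle O x) / (2 * Real.pi)⌋ : ℝ)

/-- The average number of times a ray from `O` rotating to the angle `t` passes through a
point distributed according to `μ`. -/
def sweptMass (μ : Measure (ℝ × ℝ)) (O : ℝ × ℝ) (t : ℝ) : ℝ := ∫ x, sweepCount O t x ∂μ

theorem measurable_sweepCount (O : ℝ × ℝ) (t : ℝ) : Measurable (sweepCount O t) := by
  have h : Measurable fun x => (t - polarAngle O x) / (2 * Real.pi) :=
    (measurable_const.sub (measurable_polarAngle O)).div_const _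
  exact (measurable_of_countable (fun n : ℤ => (n : ℝ))).comp h.floor

theorem abs_sweepCount_le (O : ℝ × ℝ) (t : ℝ) (x : ℝ × ℝ) : |sweepCount O t x| ≤ |t| + 2 := by
  have hπ := Real.pi_gt_three
  have h1 : |polarAngle O x| ≤ Real.pi := Complex.abs_arg_le_pi _
  have h2 : |(t - polarAngle O x) / (2 * Real.pi)| ≤ |t| + 1 := by
    rw [abs_div, abs_of_pos (by positivity : 0 < 2 * Real.pi), div_le_iff₀ (by positivity)]
    have h3 := abs_sub t (polarAngle O x)
    nlinarith [abs_nonneg t]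
  rw [abs_le] at h2 ⊢
  have h3 := Int.floor_le ((t - polarAngle O x) / (2 * Real.pi))
  have h4 := Int.lt_floor_add_one ((t - polarAngle O x) / (2 * Real.pi))
  unfold sweepCount
  constructor <;> linarith

theorem integrable_sweepCount (μ : Measure (ℝ × ℝ)) [IsProbabilityMeasure μ] (O : ℝ × ℝ) (t : ℝ) :
    Integrable (sweepCount O t) μ :=
  Integrable.of_bound (measurable_sweepCount O t).aestronglyMeasurable (|t| + 2)
    (Filter.Eventually.of_forall (abs_sweepCount_le O t))

theorem sweepCount_mono (O x : ℝ × ℝ) : Monotone fun t => sweepCount O t x := by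
  intro a b hab
  have hπ := Real.pi_pos
  refine Int.cast_le.2 (Int.floor_le_floor ?_)
  gcongr

theorem sweepCount_add_two_pi (O : ℝ × ℝ) (t : ℝ) (x : ℝ × ℝ) :
    sweepCount O (t + 2 * Real.pi) x = sweepCount O t x + 1 := by
  have hπ := Real.pi_pos
  have : (t + 2 * Real.pi - polarAngle O x) / (2 * Real.pi) =
      (t - polarAngle O x) / (2 * Real.pi) + 1 := by field_simp; ring
  rw [sweepCount, this, Int.floor_add_one]
  push_cast
  rfl

theorem continuousAt_sweepCount {O x : ℝ × ℝ} {t : ℝ} (hx : x ∉ lineThrough O t) :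
    ContinuousAt (fun t => sweepCount O t x) t := by
  have hπ := Real.pi_pos
  set g : ℝ → ℝ := fun t => (t - polarAngle O x) / (2 * Real.pi) with hg
  have hgc : Continuous g := by fun_prop
  have hne : (⌊g t⌋ : ℝ) ≠ g t := fun h => by
    apply hx
    obtain ⟨r, -, hr⟩ := exists_eq_add_polarAngle O x
    refine ⟨r, ?_⟩
    have h1 : polarAngle O x + ⌊g t⌋ * (2 * Real.pi) = t := by
      rw [h, hg]; field_simp; ring
    have h2 := hr ⌊g t⌋
    rwa [h1] at h2
  have h1 : ∀ᶠ s in nhds t, (⌊g t⌋ : ℝ) < g s :=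
    hgc.continuousAt.eventually (lt_mem_nhds (lt_of_le_of_ne (Int.floor_le _) hne))
  have h2 : ∀ᶠ s in nhds t, g s < ⌊g t⌋ + 1 :=
    hgc.continuousAt.eventually (gt_mem_nhds (Int.lt_floor_add_one _))
  refine (continuousAt_const (y := (⌊g t⌋ : ℝ))).congr ?_
  filter_upwards [h1, h2] with s hs1 hs2
  exact congrArg _ (Int.floor_eq_iff.2 ⟨hs1.le, hs2⟩).symm

theorem IsMass.ae_notMem_lineThrough {μ : Measure (ℝ × ℝ)} (hμ : IsMass μ) (O : ℝ × ℝ) (t : ℝ) :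
    ∀ᵐ x ∂μ, x ∉ lineThrough O t :=
  measure_eq_zero_iff_ae_notMem.1 (hμ.2 _ (isAffineLine_lineThrough O t))

theorem IsMass.continuous_sweptMass {μ : Measure (ℝ × ℝ)} (hμ : IsMass μ) (O : ℝ × ℝ) :
    Continuous (sweptMass μ O) := by
  have := hμ.1
  refine continuous_iff_continuousAt.2 fun t => ?_
  refine continuousAt_of_dominated (bound := fun _ => |t| + 3)
    (Filter.Eventually.of_forall fun s => (measurable_sweepCount O s).aestronglyMeasurable)
    ?_ (integrable_const _) ?_
  · filter_upwards [continuous_abs.continuousAt.eventually (gt_mem_nhds (lt_add_one |t|))] with s hs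
    refine Filter.Eventually.of_forall fun x => (abs_sweepCount_le O s x).trans ?_
    linarith
  · filter_upwards [hμ.ae_notMem_lineThrough O t] with x hx using continuousAt_sweepCount hx

theorem sweptMass_mono (μ : Measure (ℝ × ℝ)) [IsProbabilityMeasure μ] (O : ℝ × ℝ) :
    Monotone (sweptMass μ O) := fun a b hab =>
  integral_mono (integrable_sweepCount μ O a) (integrable_sweepCount μ O b)
    fun x => sweepCount_mono O x hab

theorem sweptMass_add_two_pi (μ : Measure (ℝ × ℝ)) [IsProbabilityMeasure μ] (O : ℝ × ℝ) (t : ℝ) :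
    sweptMass μ O (t + 2 * Real.pi) = sweptMass μ O t + 1 := by
  simp only [sweptMass, sweepCount_add_two_pi]
  rw [integral_add (integrable_sweepCount μ O t) (integrable_const _)]
  simp

theorem sweepCount_le_add_one (O x : ℝ × ℝ) {a b : ℝ} (h : b ≤ a + 2 * Real.pi) :
    sweepCount O b x ≤ sweepCount O a x + 1 := by
  rw [← sweepCount_add_two_pi]
  exact sweepCount_mono O x h

theorem mem_wedge_of_sweepCount_lt {O x : ℝ × ℝ} {a b : ℝ} (hab : a ≤ b)
    (h : sweepCount O a x < sweepCount O b x) : x ∈ Wedge O a b := by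
  have hπ : 0 < 2 * Real.pi := Real.two_pi_pos
  obtain ⟨r, hr, hx⟩ := exists_eq_add_polarAngle O x
  have h1 := Int.floor_le ((b - polarAngle O x) / (2 * Real.pi))
  have h2 := Int.floor_lt.1 (Int.cast_lt.1 h)
  rw [le_div_iff₀ hπ] at h1
  rw [div_lt_iff₀ hπ] at h2
  exact (mem_wedge_iff hab).2 ⟨r, hr, _, ⟨by linarith, by linarith⟩, hx _⟩

theorem sweepCount_lt_of_mem_wedge {O x : ℝ × ℝ} {a b : ℝ} (hx : x ∈ Wedge O a b)
    (hxa : x ∉ lineThrough O a) : sweepCount O a x < sweepCount O b x := by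
  have hπ : 0 < 2 * Real.pi := Real.two_pi_pos
  rcases hx with hx | ⟨r, hr, θ, hθ, rfl⟩
  · exact absurd ⟨0, by simpa using hx⟩ hxa
  obtain ⟨k, hk⟩ := exists_eq_polarAngle_add O (θ := θ) hr
  have haθ : a < θ := lt_of_le_of_ne hθ.1 fun h => hxa ⟨r, by rw [h]⟩
  set φ := polarAngle O (O + r • (Real.cos θ, Real.sin θ)) with hφ
  refine Int.cast_lt.2 (lt_of_lt_of_le (b := k) (Int.floor_lt.2 ?_) (Int.le_floor.2 ?_))
  · rw [div_lt_iff₀ hπ, ← hφ]; linarith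
  · rw [le_div_iff₀ hπ, ← hφ]; linarith [hθ.2]

theorem IsMass.real_wedge {μ : Measure (ℝ × ℝ)} (hμ : IsMass μ) (O : ℝ × ℝ) {a b : ℝ}
    (hab : a ≤ b) (hπ : b ≤ a + 2 * Real.pi) :
    μ.real (Wedge O a b) = sweptMass μ O b - sweptMass μ O a := by
  have := hμ.1
  let S : Set (ℝ × ℝ) := {x | sweepCount O a x < sweepCount O b x}
  have hS : MeasurableSet S :=
    measurableSet_lt (measurable_sweepCount O a) (measurable_sweepCount O b)
  have hWS : Wedge O a b =ᵐ[μ] S := by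
    refine Filter.eventuallyEq_set.2 ?_
    filter_upwards [hμ.ae_notMem_lineThrough O a] with x hx
    exact ⟨fun h => sweepCount_lt_of_mem_wedge h hx, fun h => mem_wedge_of_sweepCount_lt hab h⟩
  rw [measureReal_congr hWS, ← integral_indicator_one hS, sweptMass, sweptMass,
    ← integral_sub (integrable_sweepCount μ O b) (integrable_sweepCount μ O a)]
  refine integral_congr_ae (Filter.Eventually.of_forall fun x => ?_)
  have h1 := sweepCount_mono O x hab
  have h2 := sweepCount_le_add_one O x hπ
  by_cases hx : sweepCount O a x < sweepCount O b x
  · have h3 : sweepCount O a x + 1 ≤ sweepCount O b x := by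
      unfold sweepCount at hx ⊢
      exact_mod_cast hx
    have hxS : x ∈ S := hx
    simp only [Set.indicator_of_mem hxS, Pi.one_apply]
    linarith
  · have hxS : x ∉ S := hx
    simp only [Set.indicator_of_notMem hxS]
    have := le_antisymm (not_lt.1 hx) h1
    linarith

theorem halfPlane_subset_wedge (O : ℝ × ℝ) (a : ℝ) :
    {x : ℝ × ℝ | Real.cos a * O.2 - Real.sin a * O.1 ≤ Real.cos a * x.2 - Real.sin a * x.1} ⊆
      Wedge O a (a + Real.pi) := by
  intro x hx
  have hx : Real.cos a * O.2 - Real.sin a * O.1 ≤ Real.cos a * x.2 - Real.sin a * x.1 := hx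
  have hπ : 0 < Real.pi := Real.pi_pos
  obtain ⟨r, hr, hrx⟩ := exists_eq_add_polarAngle O x
  obtain ⟨k, ⟨hk1, hk2⟩, -⟩ :=
    existsUnique_add_zsmul_mem_Ico Real.two_pi_pos (polarAngle O x) a
  rw [zsmul_eq_mul] at hk1 hk2
  specialize hrx k
  set θ := polarAngle O x + k * (2 * Real.pi)
  rcases hr.eq_or_lt with rfl | hr
  · exact Or.inl (by simpa using hrx)
  refine Or.inr ⟨r, hr, θ, ⟨hk1, ?_⟩, hrx⟩
  by_contra! hlt
  have hneg : Real.sin (θ - a - 2 * Real.pi) < 0 :=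
    Real.sin_neg_of_neg_of_neg_pi_lt (by linarith) (by linarith)
  rw [Real.sin_sub_two_pi, Real.sin_sub] at hneg
  have h1 : x.1 = O.1 + r * Real.cos θ := congrArg Prod.fst hrx
  have h2 : x.2 = O.2 + r * Real.sin θ := congrArg Prod.snd hrx
  rw [h1, h2] at hx
  nlinarith [mul_neg_of_pos_of_neg hr hneg]

theorem IsMass.exists_forall_sweptMass_add_pi {μ : Measure (ℝ × ℝ)} (hμ : IsMass μ) :
    ∃ O : ℝ × ℝ, ∀ t : ℝ, sweptMass μ O t + 1 / 3 ≤ sweptMass μ O (t + Real.pi) := by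
  have := hμ.1
  have hπ := Real.pi_pos
  obtain ⟨O, hO⟩ := exists_centerpoint μ
  refine ⟨O, fun t => ?_⟩
  have h1 := hO (Real.cos t • ContinuousLinearMap.snd ℝ ℝ ℝ -
    Real.sin t • ContinuousLinearMap.fst ℝ ℝ ℝ)
  have h2 := h1.trans (measureReal_mono (halfPlane_subset_wedge O t))
  rw [hμ.real_wedge O (by linarith) (by linarith)] at h2
  norm_num at h2
  linarith

theorem exists_isLeast_of_add_period {F : ℝ → ℝ} (hF : Continuous F) (hmono : Monotone F) {T : ℝ}
    (hT : ∀ t, F (t + T) = F t + 1) (c : ℝ) : ∃ t, F t = c ∧ IsLeast {s | c ≤ F s} t := by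
  have hn : ∀ n : ℕ, F (n * T) = F 0 + n := by
    intro n
    induction n with
    | zero => simp
    | succ n ih => rw [Nat.cast_succ, add_one_mul, hT, ih]; ring
  have hn' : ∀ n : ℕ, F (-(n * T)) = F 0 - n := by
    intro n
    induction n with
    | zero => simp
    | succ n ih =>
      have := hT (-((n + 1 : ℕ) * T))
      rw [show -((n + 1 : ℕ) * T) + T = -(n * T) by push_cast; ring, ih] at this
      push_cast at this ⊢
      linarith
  have hlo : ∃ s, F s < c := by
    obtain ⟨n, h⟩ := exists_nat_gt (F 0 - c)
    exact ⟨_, by rw [hn' n]; linarith⟩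
  have hhi : ∃ s, c ≤ F s := by
    obtain ⟨n, h⟩ := exists_nat_ge (c - F 0)
    exact ⟨_, by rw [hn n]; linarith⟩
  obtain ⟨s, hs⟩ := mem_range_of_exists_le_of_exists_ge hF (hlo.imp fun _ => le_of_lt) hhi
  obtain ⟨l, hl⟩ := hlo
  have hbdd : BddBelow {s | c ≤ F s} :=
    ⟨l, fun u hu => le_of_not_gt fun h => (hl.trans_le hu).not_ge (hmono h.le)⟩
  have hleast : IsLeast {s | c ≤ F s} (sInf {s | c ≤ F s}) :=
    (isClosed_le continuous_const hF).isLeast_csInf hhi hbdd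
  exact ⟨_, le_antisymm ((hmono (hleast.2 hs.ge)).trans hs.le) hleast.1, hleast⟩

/-- If `q ≥ 3p` with `p, q` coprime, every mass admits a `(q,p)`-spiral equicovering. -/
theorem spiral_equicovering_of_three_p_le_q (p q : ℕ) (hp : 0 < p) (hq : 3 * p ≤ q)
    (hcop : Nat.Coprime p q) :
    ∀ μ : Measure (ℝ × ℝ), IsMass μ → IsSpiralEquicovering μ q p := by
  intro μ hμ
  have := hμ.1
  have hπ := Real.pi_pos
  have hq0 : (0 : ℝ) < q := by exact_mod_cast (by omega : 0 < q)
  have hpq : (p : ℝ) / q ≤ 1 / 3 := by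
    rw [div_le_div_iff₀ hq0 (by norm_num)]
    exact_mod_cast (by omega : p * 3 ≤ 1 * q)
  obtain ⟨O, hO⟩ := hμ.exists_forall_sweptMass_add_pi
  choose τ hτ hleast using exists_isLeast_of_add_period (hμ.continuous_sweptMass O)
    (sweptMass_mono μ O) (sweptMass_add_two_pi μ O)
  have hτmono : Monotone τ := fun c d hcd => (hleast c).2 (hcd.trans (hleast d).1)
  have hτadd : ∀ c, τ (c + 1) = τ c + 2 * Real.pi := by
    intro c
    have h1 : τ (c + 1) ≤ τ c + 2 * Real.pi :=
      (hleast _).2 (show c + 1 ≤ _ by rw [sweptMass_add_two_pi, hτ])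
    have h2 : τ c ≤ τ (c + 1) - 2 * Real.pi := (hleast _).2 (show c ≤ _ by
      have := sweptMass_add_two_pi μ O (τ (c + 1) - 2 * Real.pi)
      rw [sub_add_cancel, hτ] at this
      linarith)
    linarith
  refine ⟨O, fun j => τ (j / q), fun j => ?_, fun j => hτmono ?_, fun i => ?_⟩
  · rw [← hτadd]
    push_cast
    field_simp
  · push_cast
    gcongr
    linarith
  · have hle : τ (i / q) ≤ τ ((i + (p : ℤ) : ℤ) / q) := hτmono (by push_cast; gcongr; simp)
    have heq : ((i + (p : ℤ) : ℤ) / q : ℝ) = i / q + p / q := by push_cast; ring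
    have hwidth : τ ((i + (p : ℤ) : ℤ) / q) ≤ τ (i / q) + Real.pi :=
      (hleast _).2 (show _ ≤ sweptMass μ O _ by
        have := hO (τ (i / q))
        rw [hτ] at this
        rw [heq]
        linarith)
    refine ⟨convex_wedge hle (by linarith), ?_⟩
    rw [← ofReal_measureReal, hμ.real_wedge O hle (by linarith), hτ, hτ, heq, add_sub_cancel_left]
end
end

section
/- Let p ≥ 3 be an odd integer, let q = 3p − 3, and assume gcd(p, q) = 1. Then every mass μ on ℝ² admits a (q,p)-spiral equicovering. -/
open MeasureTheory

noncomputable section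

/-- The unit vector at angle `θ`. -/
def dir (θ : ℝ) : ℝ × ℝ := (Real.cos θ, Real.sin θ)

lemma dir_add_pi (t : ℝ) : dir (t + Real.pi) = -dir t := by
  simp [dir]

lemma continuous_dir : Continuous dir := by
  unfold dir; fun_prop

/-- The properties of the cumulative angular distribution `F O θ` around the points `O` of the
plane, for a mass with full support. -/
structure IsRadialCDF (F : ℝ × ℝ → ℝ → ℝ) : Prop where
  cont : Continuous (fun z : (ℝ × ℝ) × ℝ => F z.1 z.2)
  mono : ∀ O, StrictMono (F O)
  period : ∀ O θ, F O (θ + 2 * Real.pi) = F O θ + 1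
  forward : ∀ (O : ℝ × ℝ) (t δ φ : ℝ), 0 < δ → t < φ → φ < t + Real.pi →
    F (O + δ • dir t) φ - F (O + δ • dir t) t < F O φ - F O t
  along : ∀ (O : ℝ × ℝ) (t δ : ℝ), F (O + δ • dir t) (t + Real.pi) - F (O + δ • dir t) t
    = F O (t + Real.pi) - F O t
  across : ∀ (O : ℝ × ℝ) (t δ : ℝ), 0 < δ →
    F (O + δ • dir (t + Real.pi / 2)) (t + Real.pi) - F (O + δ • dir (t + Real.pi / 2)) t
      < F O (t + Real.pi) - F O t
  tail : ∀ ε > 0, ∃ R : ℝ, ∀ (O : ℝ × ℝ) (t : ℝ),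
    R ≤ (dir (t + Real.pi / 2)).1 * O.1 + (dir (t + Real.pi / 2)).2 * O.2 →
      F O (t + Real.pi) - F O t < ε

/-- The zeros of a continuous family of strictly increasing functions depend continuously on the
parameter. -/
lemma exists_continuous_zero {X : Type*} [TopologicalSpace X] (Φ : X → ℝ → ℝ)
    (hc : Continuous fun z : X × ℝ => Φ z.1 z.2) (hm : ∀ x, StrictMono (Φ x))
    (hz : ∀ x, ∃ y, Φ x y = 0) : ∃ f : X → ℝ, Continuous f ∧ ∀ x, Φ x (f x) = 0 := by
  choose f hf using hz
  refine ⟨f, ?_, hf⟩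
  have hcy : ∀ y, Continuous fun x => Φ x y := fun y =>
    hc.comp (continuous_id.prodMk continuous_const)
  rw [continuous_iff_continuousAt]
  intro x
  rw [ContinuousAt, tendsto_order]
  constructor
  · intro a ha
    have h1 : Φ x a < 0 := by rw [← hf x]; exact hm x ha
    filter_upwards [(hcy a).continuousAt.eventually_lt continuousAt_const h1] with x' hx'
    rw [← hf x'] at hx'
    exact (hm x').lt_iff_lt.1 hx'
  · intro a ha
    have h1 : 0 < Φ x a := by rw [← hf x]; exact hm x ha
    filter_upwards [continuousAt_const.eventually_lt (hcy a).continuousAt h1] with x' hx'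
    rw [← hf x'] at hx'
    exact (hm x').lt_iff_lt.1 hx'

namespace IsRadialCDF

variable {F : ℝ × ℝ → ℝ → ℝ}

lemma add_nat_mul_period (hF : IsRadialCDF F) (O : ℝ × ℝ) (θ : ℝ) (n : ℕ) :
    F O (θ + n * (2 * Real.pi)) = F O θ + n := by
  induction n with
  | zero => simp
  | succ k ih =>
    rw [show θ + ((k + 1 : ℕ) : ℝ) * (2 * Real.pi) = θ + k * (2 * Real.pi) + 2 * Real.pi by
      push_cast; ring, hF.period, ih]
    push_cast; ring

lemma continuous_right (hF : IsRadialCDF F) (O : ℝ × ℝ) : Continuous (F O) :=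
  hF.cont.comp (continuous_const.prodMk continuous_id)

lemma continuous_comp (hF : IsRadialCDF F) {X : Type*} [TopologicalSpace X] {f : X → ℝ × ℝ}
    {g : X → ℝ} (hf : Continuous f) (hg : Continuous g) : Continuous fun x => F (f x) (g x) :=
  hF.cont.comp (hf.prodMk hg)

lemma surjective (hF : IsRadialCDF F) (O : ℝ × ℝ) : Function.Surjective (F O) := by
  intro y
  apply mem_range_of_exists_le_of_exists_ge (hF.continuous_right O)
  · obtain ⟨n, hn⟩ := exists_nat_ge (F O 0 - y)
    refine ⟨0 - n * (2 * Real.pi), ?_⟩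
    have := hF.add_nat_mul_period O (0 - n * (2 * Real.pi)) n
    rw [sub_add_cancel] at this
    linarith
  · obtain ⟨n, hn⟩ := exists_nat_ge (y - F O 0)
    refine ⟨0 + n * (2 * Real.pi), ?_⟩
    rw [hF.add_nat_mul_period]
    linarith

lemma exists_quantile (hF : IsRadialCDF F) : ∃ G : (ℝ × ℝ) × ℝ → ℝ, Continuous G ∧
    ∀ O y, F O (G (O, y)) = y := by
  obtain ⟨G, hG, h⟩ := exists_continuous_zero (fun (z : (ℝ × ℝ) × ℝ) θ => F z.1 θ - z.2)
    ((hF.continuous_comp (by fun_prop) (by fun_prop)).sub (by fun_prop))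
    (fun z a b hab => sub_lt_sub_right (hF.mono z.1 hab) _)
    (fun z => by
      obtain ⟨y, hy⟩ := hF.surjective z.1 z.2
      exact ⟨y, by simp [hy]⟩)
  exact ⟨G, hG, fun O y => by linarith [h (O, y)]⟩

lemma across_strictAnti (hF : IsRadialCDF F) (t : ℝ) :
    StrictAnti fun h : ℝ => F (h • dir (t + Real.pi / 2)) (t + Real.pi)
      - F (h • dir (t + Real.pi / 2)) t := by
  intro a b hab
  have := hF.across (a • dir (t + Real.pi / 2)) t (b - a) (by linarith)
  rw [← add_smul, add_sub_cancel] at this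
  exact this

lemma dir_dot_self (t h : ℝ) :
    (dir t).1 * (h • dir t).1 + (dir t).2 * (h • dir t).2 = h := by
  simp only [dir, Prod.smul_mk, smul_eq_mul]
  linear_combination h * Real.cos_sq_add_sin_sq t

lemma exists_halving (hF : IsRadialCDF F) : ∃ h : ℝ → ℝ, Continuous h ∧
    ∀ t, F (h t • dir (t + Real.pi / 2)) (t + Real.pi)
      = F (h t • dir (t + Real.pi / 2)) t + 1 / 2 := by
  have key := exists_continuous_zero (fun (t : ℝ) (h : ℝ) =>
      F (h • dir (t + Real.pi / 2)) t + 1 / 2 - F (h • dir (t + Real.pi / 2)) (t + Real.pi)) ?_ ?_ ?_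
  · obtain ⟨h, hc, hh⟩ := key
    exact ⟨h, hc, fun t => by linarith [hh t]⟩
  · have h1 : Continuous fun z : ℝ × ℝ => z.2 • dir (z.1 + Real.pi / 2) :=
      continuous_snd.smul (continuous_dir.comp (by fun_prop))
    exact ((hF.continuous_comp h1 (by fun_prop)).add continuous_const).sub
      (hF.continuous_comp h1 (by fun_prop))
  · intro t a b hab
    have := hF.across_strictAnti t hab
    simp only at this ⊢
    linarith
  · intro t
    have hcont : Continuous fun h : ℝ => F (h • dir (t + Real.pi / 2)) t + 1 / 2
        - F (h • dir (t + Real.pi / 2)) (t + Real.pi) := by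
      have h1 : Continuous fun z : ℝ => z • dir (t + Real.pi / 2) := by fun_prop
      exact ((hF.continuous_comp h1 (by fun_prop)).add continuous_const).sub
        (hF.continuous_comp h1 (by fun_prop))
    obtain ⟨R, hR⟩ := hF.tail (1 / 2) (by norm_num)
    apply mem_range_of_exists_le_of_exists_ge hcont
    · refine ⟨-R, ?_⟩
      have h1 := hR ((-R) • dir (t + Real.pi / 2)) (t + Real.pi) (by
        rw [show t + Real.pi + Real.pi / 2 = t + Real.pi / 2 + Real.pi by ring, dir_add_pi]
        have := dir_dot_self (t + Real.pi / 2) (-R)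
        simp only [Prod.fst_neg, Prod.snd_neg]
        linarith)
      have h2 := hF.period ((-R) • dir (t + Real.pi / 2)) t
      rw [show t + Real.pi + Real.pi = t + 2 * Real.pi by ring] at h1
      linarith
    · refine ⟨R, ?_⟩
      have h1 := hR (R • dir (t + Real.pi / 2)) t (dir_dot_self _ _).ge
      linarith

/-- The fan of `2r` rays cutting the mass into equal parts, whose rays numbered `0` and `r` are
opposite with directions `t` and `t + π`; `s` is the position of the apex along the halving
line. -/
lemma exists_fan (hF : IsRadialCDF F) (r : ℤ) (hr : 2 ≤ r) :
    ∃ (P : ℝ → ℝ → ℝ × ℝ) (θ : ℤ → ℝ → ℝ → ℝ),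
      (∀ k, Continuous fun z : ℝ × ℝ => θ k z.1 z.2) ∧
      (∀ k t s, F (P t s) (θ k t s) = F (P t s) t + k / (2 * r)) ∧
      (∀ t s, θ 0 t s = t) ∧
      (∀ t s, θ r t s = t + Real.pi) ∧
      (∀ k t s, θ (k + 2 * r) t s = θ k t s + 2 * Real.pi) ∧
      (∀ t s, StrictMono fun k => θ k t s) ∧
      (∀ k t s, θ k (t + Real.pi) (-s) = θ (k + r) t s) ∧
      (∀ k t, 0 < k → k < r → StrictMono (θ k t)) ∧
      (∀ k t, r < k → k < 2 * r → StrictAnti (θ k t)) ∧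
      (∀ t, ∃ s, t + Real.pi / 2 ≤ θ 1 t s ∧ θ (-1) t s ≤ t - Real.pi / 2) := by
  have hr0 : (0 : ℝ) < r := by exact_mod_cast (by omega : (0 : ℤ) < r)
  obtain ⟨G, hGc, hG⟩ := hF.exists_quantile
  obtain ⟨h, hc, hh⟩ := hF.exists_halving
  have hpi := Real.pi_pos
  have hanti : ∀ t, h (t + Real.pi) = -h t := by
    intro t
    apply (hF.across_strictAnti (t + Real.pi)).injective
    have h1 := hh (t + Real.pi)
    have h2 := hh t
    simp only
    rw [h1]
    rw [show t + Real.pi + Real.pi / 2 = t + Real.pi / 2 + Real.pi by ring, dir_add_pi, neg_smul_neg,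
      show t + Real.pi + Real.pi = t + 2 * Real.pi by ring, hF.period, h2]
    ring
  set P : ℝ → ℝ → ℝ × ℝ := fun t s => h t • dir (t + Real.pi / 2) + s • dir t with hP
  have hPhalf : ∀ t s, F (P t s) (t + Real.pi) = F (P t s) t + 1 / 2 := by
    intro t s
    have := hF.along (h t • dir (t + Real.pi / 2)) t s
    have h2 := hh t
    simp only [hP]
    linarith
  have hPsymm : ∀ t s, P (t + Real.pi) (-s) = P t s := by
    intro t s
    simp only [hP]
    rw [hanti, show t + Real.pi + Real.pi / 2 = t + Real.pi / 2 + Real.pi by ring, dir_add_pi,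
      dir_add_pi, neg_smul_neg, neg_smul_neg]
  have hPadd : ∀ t a b, P t b = P t a + (b - a) • dir t := by
    intro t a b
    simp only [hP, sub_smul]
    abel
  have hPc : Continuous fun z : ℝ × ℝ => P z.1 z.2 := by
    have h1 : Continuous fun z : ℝ × ℝ => dir (z.1 + Real.pi / 2) :=
      continuous_dir.comp (by fun_prop)
    have h2 : Continuous fun z : ℝ × ℝ => dir z.1 := continuous_dir.comp (by fun_prop)
    have h3 : Continuous fun z : ℝ × ℝ => h z.1 := hc.comp continuous_fst
    exact (h3.smul h1).add (continuous_snd.smul h2)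
  have hinj := fun O => (hF.mono O).injective
  set θ : ℤ → ℝ → ℝ → ℝ := fun k t s => G (P t s, F (P t s) t + k / (2 * r)) with hθ
  have hFθ : ∀ k t s, F (P t s) (θ k t s) = F (P t s) t + k / (2 * r) := fun k t s => hG _ _
  have hθ0 : ∀ t s, θ 0 t s = t := by
    intro t s
    apply hinj (P t s)
    rw [hFθ]; simp
  have hθr : ∀ t s, θ r t s = t + Real.pi := by
    intro t s
    apply hinj (P t s)
    rw [hFθ, hPhalf]; field_simp
  have hθm : ∀ t s, StrictMono fun k => θ k t s := by
    intro t s k l hkl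
    have hkl' : (k : ℝ) < l := by exact_mod_cast hkl
    apply (hF.mono (P t s)).lt_iff_lt.1
    rw [hFθ, hFθ]
    gcongr
  have hθp : ∀ k t s, θ (k + 2 * r) t s = θ k t s + 2 * Real.pi := by
    intro k t s
    apply hinj (P t s)
    rw [hFθ, hF.period, hFθ]; push_cast; field_simp; ring
  refine ⟨P, θ, ?_, hFθ, hθ0, hθr, hθp, hθm, ?_, ?_, ?_, ?_⟩
  · intro k
    exact hGc.comp (hPc.prodMk ((hF.continuous_comp hPc continuous_fst).add continuous_const))
  · intro k t s
    apply hinj (P t s)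
    rw [hFθ, ← hPsymm, hFθ, hPsymm, hPhalf]
    push_cast; field_simp; ring
  · intro k t hk hkr a b hab
    have h1 := hθm t a hk
    have h2 := hθm t a hkr
    simp only [hθ0, hθr] at h1 h2
    have h3 := hF.forward (P t a) t (b - a) (θ k t a) (by linarith) h1 h2
    rw [← hPadd] at h3
    apply (hF.mono (P t b)).lt_iff_lt.1
    have h4 := hFθ k t a
    have h5 := hFθ k t b
    linarith
  · intro k t hk hkr a b hab
    have h1 := hθm t b hk
    have h2 := hθm t b hkr
    have h6 := hθp 0 t b
    rw [zero_add, hθ0] at h6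
    simp only [hθr, h6] at h1 h2
    have h3 := hF.forward (P t b) (t + Real.pi) (b - a) (θ k t b) (by linarith) h1 (by linarith)
    rw [dir_add_pi, smul_neg, ← sub_eq_add_neg, ← neg_smul_neg, neg_sub] at h3
    rw [show P t b - (a - b) • -dir t = P t a by rw [hPadd t b a, smul_neg, sub_neg_eq_add]] at h3
    apply (hF.mono (P t a)).lt_iff_lt.1
    have h4 := hFθ k t a
    have h5 := hFθ k t b
    have h7 := hPhalf t a
    have h8 := hPhalf t b
    linarith
  · intro t
    obtain ⟨R, hR⟩ := hF.tail (1 / (2 * r)) (by positivity)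
    refine ⟨R, ?_⟩
    have h1 := hR (P t R) (t - Real.pi / 2) (by
      rw [sub_add_cancel]
      have e1 := dir_dot_self t R
      simp only [hP, dir, Real.cos_add_pi_div_two, Real.sin_add_pi_div_two, Prod.smul_mk,
        Prod.mk_add_mk, smul_eq_mul] at e1 ⊢
      nlinarith)
    rw [show t - Real.pi / 2 + Real.pi = t + Real.pi / 2 by ring] at h1
    have h2 := hF.mono (P t R) (show t - Real.pi / 2 < t by linarith)
    have h3 := hF.mono (P t R) (show t < t + Real.pi / 2 by linarith)
    have h4 := hFθ 1 t R
    have h5 := hFθ (-1) t R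
    push_cast at h4 h5
    rw [neg_div] at h5
    constructor
    · apply (hF.mono (P t R)).le_iff_le.1; linarith
    · apply (hF.mono (P t R)).le_iff_le.1; linarith

/-- Around some point there is a fan of `6m` rays cutting the mass into equal parts such that any
`2m + 1` consecutive parts span an angle of at most `π`. -/
lemma exists_equipartition (hF : IsRadialCDF F) (m : ℤ) (hm : 1 ≤ m) :
    ∃ (O : ℝ × ℝ) (θ : ℤ → ℝ),
      (∀ k, θ (k + 6 * m) = θ k + 2 * Real.pi) ∧
      StrictMono θ ∧
      (∀ k, F O (θ k) = F O (θ 0) + k / (6 * m)) ∧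
      (∀ k, θ (k + (2 * m + 1)) - θ k ≤ Real.pi) := by
  have hpi := Real.pi_pos
  obtain ⟨P, θ, hc, hFθ, hθ0, hθr, hθp, hθm, hflip, hinc, hdec, hfar⟩ :=
    hF.exists_fan (3 * m) (by omega)
  have e6 : 2 * (3 * m) = 6 * m := by ring
  rw [e6] at hdec
  simp only [e6] at hθp
  set w : ℤ → ℝ → ℝ → ℝ := fun k t s => θ (k + (2 * m + 1)) t s - θ k t s with hw
  have hwp : ∀ t s, Function.Periodic (fun k => w k t s) (6 * m) := by
    intro t s k
    simp only [hw]
    rw [show k + 6 * m + (2 * m + 1) = k + (2 * m + 1) + 6 * m by ring, hθp, hθp]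
    ring
  have hwp' : ∀ k t s, w (k + 6 * m) t s = w k t s := fun k t s => hwp t s k
  have hwflip : ∀ k t s, w k (t + Real.pi) (-s) = w (k + 3 * m) t s := by
    intro k t s
    simp only [hw]
    rw [hflip, hflip]
    congr 2
    ring
  have hwc : ∀ k, Continuous fun z : ℝ × ℝ => w k z.1 z.2 := fun k => (hc _).sub (hc _)
  set I : Finset ℤ := Finset.Icc 1 (2 * m) with hI
  have hne : I.Nonempty := Finset.nonempty_Icc.2 (by omega)
  have hw0 : ∀ j ∈ I, ∀ t, StrictMono (w (-j) t) := by
    intro j hj t a b hab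
    rw [hI, Finset.mem_Icc] at hj
    have h1 := hinc (-j + (2 * m + 1)) t (by omega) (by omega) hab
    have h2 := hdec (-j + 6 * m) t (by omega) (by omega) hab
    rw [hθp, hθp] at h2
    simp only [hw]
    linarith
  have hw1 : ∀ j ∈ I, ∀ t, StrictAnti (w (3 * m - j) t) := by
    intro j hj t a b hab
    have h1 := hw0 j hj (t + Real.pi) (neg_lt_neg hab)
    rw [hwflip, hwflip, show -j + 3 * m = 3 * m - j by ring] at h1
    exact h1
  have hwle : ∀ t s, (∀ j ∈ I, w (-j) t s ≤ Real.pi) → (∀ j ∈ I, w (3 * m - j) t s ≤ Real.pi) →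
      ∀ k, w k t s ≤ Real.pi := by
    intro t s h0 h1 k
    have hk : w k t s = w (k % (6 * m)) t s := by
      have := (hwp t s).zsmul (k / (6 * m)) (k % (6 * m))
      simp only [smul_eq_mul] at this
      rw [← this, mul_comm (k / (6 * m)), Int.emod_add_mul_ediv]
    have hk0 := Int.emod_nonneg k (show 6 * m ≠ 0 by omega)
    have hk1 := Int.emod_lt_of_pos k (show 0 < 6 * m by omega)
    rw [hk]
    generalize k % (6 * m) = l at hk0 hk1
    by_cases c1 : l ≤ m - 1
    · have a1 := (hθm t s).monotone hk0
      have a2 := (hθm t s).monotone (show l + (2 * m + 1) ≤ 3 * m by omega)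
      simp only [hθ0, hθr] at a1 a2
      simp only [hw]
      linarith
    by_cases c2 : l < 3 * m
    · have := h1 (3 * m - l) (by rw [hI, Finset.mem_Icc]; omega)
      rwa [show 3 * m - (3 * m - l) = l by ring] at this
    by_cases c3 : l ≤ 4 * m - 1
    · have a1 := (hθm t s).monotone (show 3 * m ≤ l by omega)
      have a2 := (hθm t s).monotone (show l + (2 * m + 1) ≤ 0 + 6 * m by omega)
      simp only [hθp, hθ0, hθr] at a1 a2
      simp only [hw]
      linarith
    · have := h0 (6 * m - l) (by rw [hI, Finset.mem_Icc]; omega)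
      rwa [show -(6 * m - l) = l - 6 * m by ring, ← hwp', sub_add_cancel] at this
  by_contra hcon
  have hbad : ∀ t s, ¬ ∀ k, w k t s ≤ Real.pi := by
    intro t s h
    refine hcon ⟨P t s, fun k => θ k t s, fun k => hθp k t s, hθm t s, fun k => ?_, h⟩
    simp only [hFθ, hθ0]
    push_cast
    congr 2
    ring
  set g0 : ℝ → ℝ → ℝ := fun t s => I.sup' hne fun j => w (-j) t s with hg0
  set g1 : ℝ → ℝ → ℝ := fun t s => I.sup' hne fun j => w (3 * m - j) t s with hg1
  have hg0c : Continuous fun z : ℝ × ℝ => g0 z.1 z.2 :=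
    Continuous.finset_sup'_apply hne fun j _ => hwc _
  have hg1c : Continuous fun z : ℝ × ℝ => g1 z.1 z.2 :=
    Continuous.finset_sup'_apply hne fun j _ => hwc _
  have hg0m : ∀ t, StrictMono (g0 t) := by
    intro t a b hab
    simp only [hg0]
    rw [Finset.sup'_lt_iff]
    intro j hj
    exact (hw0 j hj t hab).trans_le (Finset.le_sup' (fun j => w (-j) t b) hj)
  have hg1m : ∀ t, StrictAnti (g1 t) := by
    intro t a b hab
    simp only [hg1]
    rw [Finset.sup'_lt_iff]
    intro j hj
    exact (hw1 j hj t hab).trans_le (Finset.le_sup' (fun j => w (3 * m - j) t a) hj)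
  have hg01 : ∀ t s, g0 (t + Real.pi) (-s) = g1 t s := by
    intro t s
    simp only [hg0, hg1]
    refine Finset.sup'_congr hne rfl fun j _ => ?_
    rw [hwflip]
    congr 1
    ring
  have hg10 : ∀ t s, g1 (t + Real.pi) (-s) = g0 t s := by
    intro t s
    simp only [hg0, hg1]
    refine Finset.sup'_congr hne rfl fun j _ => ?_
    rw [hwflip, ← hwp' (-j)]
    congr 1
    ring
  have hbig : ∀ t, ∃ s, 0 ≤ g0 t s - g1 t s := by
    intro t
    obtain ⟨s, h1, h2⟩ := hfar t
    refine ⟨s, ?_⟩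
    have a0 : Real.pi ≤ g0 t s := by
      refine le_trans ?_ (Finset.le_sup' (fun j => w (-j) t s) (show (1 : ℤ) ∈ I by
        rw [hI, Finset.mem_Icc]; omega))
      have := (hθm t s).monotone (show 1 ≤ -1 + (2 * m + 1) by omega)
      simp only [hw] at this ⊢
      linarith
    have a1 : g1 t s ≤ Real.pi := by
      simp only [hg1]
      rw [Finset.sup'_le_iff]
      intro j hj
      rw [hI, Finset.mem_Icc] at hj
      have b1 := (hθm t s).monotone (show 1 ≤ 3 * m - j by omega)
      have b2 := (hθm t s).monotone (show 3 * m - j + (2 * m + 1) ≤ -1 + 6 * m by omega)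
      simp only [hθp] at b2
      simp only [hw] at b1 ⊢
      linarith
    linarith
  obtain ⟨σ, hσc, hσ⟩ := exists_continuous_zero (fun t s => g0 t s - g1 t s) (hg0c.sub hg1c)
    (fun t a b hab => by have := hg0m t hab; have := hg1m t hab; simp only; linarith)
    (fun t => by
      have hct : Continuous fun s : ℝ => g0 t s - g1 t s :=
        (hg0c.sub hg1c).comp (continuous_const.prodMk continuous_id)
      apply mem_range_of_exists_le_of_exists_ge hct
      · obtain ⟨s, hs⟩ := hbig (t - Real.pi)
        refine ⟨-s, ?_⟩
        have b1 := hg01 (t - Real.pi) s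
        have b2 := hg10 (t - Real.pi) s
        rw [sub_add_cancel] at b1 b2
        rw [b1, b2]
        linarith
      · exact hbig t)
  have hσflip : ∀ t, σ (t + Real.pi) = -σ t := by
    intro t
    have hinj : StrictMono fun s => g0 (t + Real.pi) s - g1 (t + Real.pi) s := fun a b hab => by
      have := hg0m (t + Real.pi) hab
      have := hg1m (t + Real.pi) hab
      simp only
      linarith
    apply hinj.injective
    have h1 := hσ t
    have h2 := hσ (t + Real.pi)
    simp only at h1 h2 ⊢
    rw [h2, hg01, hg10]
    linarith
  have hviol : ∀ t, ∃ i ∈ I, ∃ j ∈ I, Real.pi < w (-i) t (σ t) ∧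
      Real.pi < w (3 * m - j) t (σ t) := by
    intro t
    obtain ⟨i, hi, hi'⟩ := Finset.exists_mem_eq_sup' hne fun j => w (-j) t (σ t)
    obtain ⟨j, hj, hj'⟩ := Finset.exists_mem_eq_sup' hne fun j => w (3 * m - j) t (σ t)
    have h1 : g0 t (σ t) = w (-i) t (σ t) := hi'
    have h2 : g1 t (σ t) = w (3 * m - j) t (σ t) := hj'
    have h3 := hσ t
    refine ⟨i, hi, j, hj, ?_⟩
    by_contra hle
    apply hbad t (σ t)
    have h4 : g0 t (σ t) ≤ Real.pi := by
      by_contra h5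
      exact hle ⟨by linarith, by linarith⟩
    have h5 : g1 t (σ t) ≤ Real.pi := by linarith
    apply hwle
    · intro l hl
      exact (Finset.le_sup' (fun j => w (-j) t (σ t)) hl).trans h4
    · intro l hl
      exact (Finset.le_sup' (fun j => w (3 * m - j) t (σ t)) hl).trans h5
  have hover : ∀ t s i j, Real.pi < w (-i) t s → Real.pi < w (3 * m - j) t s →
      m ≤ j - i ∨ m ≤ i - j := by
    intro t s i j hi hj
    by_contra hlt
    have a1 := (hθm t s).monotone (show -i + (2 * m + 1) ≤ 3 * m - j by omega)
    have a2 := (hθm t s).monotone (show 3 * m - j + (2 * m + 1) ≤ -i + 6 * m by omega)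
    simp only [hθp] at a2
    simp only [hw] at a1 hi hj
    linarith
  have hopen : ∀ i j, IsOpen {t | Real.pi < w (-i) t (σ t) ∧ Real.pi < w (3 * m - j) t (σ t)} := by
    intro i j
    have hk : ∀ k, Continuous fun t => w k t (σ t) := fun k =>
      (hwc k).comp (continuous_id.prodMk hσc)
    exact (isOpen_lt continuous_const (hk _)).inter (isOpen_lt continuous_const (hk _))
  set U : Set ℝ := {t | ∃ i ∈ I, ∃ j ∈ I, m ≤ j - i ∧ Real.pi < w (-i) t (σ t) ∧
    Real.pi < w (3 * m - j) t (σ t)} with hU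
  set D : Set ℝ := {t | ∃ i ∈ I, ∃ j ∈ I, m ≤ i - j ∧ Real.pi < w (-i) t (σ t) ∧
    Real.pi < w (3 * m - j) t (σ t)} with hD
  have hUo : IsOpen U := by
    rw [isOpen_iff_mem_nhds]
    rintro t ⟨i, hi, j, hj, hij, ht⟩
    filter_upwards [(hopen i j).mem_nhds ht] with t' ht'
    exact ⟨i, hi, j, hj, hij, ht'⟩
  have hDo : IsOpen D := by
    rw [isOpen_iff_mem_nhds]
    rintro t ⟨i, hi, j, hj, hij, ht⟩
    filter_upwards [(hopen i j).mem_nhds ht] with t' ht'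
    exact ⟨i, hi, j, hj, hij, ht'⟩
  have hdisj : ∀ t, t ∈ U → t ∉ D := by
    rintro t ⟨i, hi, j, hj, hij, h1, h2⟩ ⟨i', hi', j', hj', hij', h1', h2'⟩
    rw [hI, Finset.mem_Icc] at hi hj hi' hj'
    rcases hover t (σ t) i j' h1 h2' with h | h <;> omega
  have hcover : ∀ t, t ∈ U ∨ t ∈ D := by
    intro t
    obtain ⟨i, hi, j, hj, h1, h2⟩ := hviol t
    rcases hover t (σ t) i j h1 h2 with h | h
    · exact Or.inl ⟨i, hi, j, hj, h, h1, h2⟩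
    · exact Or.inr ⟨i, hi, j, hj, h, h1, h2⟩
  have hswap : ∀ t i j, (Real.pi < w (-i) t (σ t) ∧ Real.pi < w (3 * m - j) t (σ t)) →
      Real.pi < w (-j) (t + Real.pi) (σ (t + Real.pi)) ∧
        Real.pi < w (3 * m - i) (t + Real.pi) (σ (t + Real.pi)) := by
    intro t i j ⟨h1, h2⟩
    rw [hσflip, hwflip, hwflip]
    constructor
    · rwa [show -j + 3 * m = 3 * m - j by ring]
    · rwa [show 3 * m - i + 3 * m = -i + 6 * m by ring, hwp']
  have hUD : ∀ t, t ∈ U → t + Real.pi ∈ D := by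
    rintro t ⟨i, hi, j, hj, hij, h⟩
    exact ⟨j, hj, i, hi, hij, hswap t i j h⟩
  have hDU : ∀ t, t ∈ D → t + Real.pi ∈ U := by
    rintro t ⟨i, hi, j, hj, hij, h⟩
    exact ⟨j, hj, i, hi, hij, hswap t i j h⟩
  rcases isPreconnected_iff_subset_of_disjoint.1 (isPreconnected_univ (α := ℝ)) U D hUo hDo
    (fun t _ => hcover t) (by ext t; simpa using hdisj t) with h | h
  · exact hdisj _ (h (Set.mem_univ _)) (hUD 0 (h (Set.mem_univ _)))
  · exact hdisj _ (hDU 0 (h (Set.mem_univ _))) (h (Set.mem_univ _))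

end IsRadialCDF

/-- The cross product of two vectors of the plane. -/
def cross (v w : ℝ × ℝ) : ℝ := v.1 * w.2 - v.2 * w.1

lemma continuous_cross_left (O : ℝ × ℝ) (v : ℝ × ℝ) : Continuous fun x => cross v (x - O) := by
  unfold cross; fun_prop

lemma continuous_cross_right (O : ℝ × ℝ) (v : ℝ × ℝ) : Continuous fun x => cross (x - O) v := by
  unfold cross; fun_prop

lemma cross_dir_dir (α β : ℝ) : cross (dir α) (dir β) = Real.sin (β - α) := by
  rw [Real.sin_sub]; simp only [cross, dir]; ring

lemma cross_smul_right (c : ℝ) (v w : ℝ × ℝ) : cross v (c • w) = c * cross v w := by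
  simp only [cross, Prod.smul_fst, Prod.smul_snd, smul_eq_mul]; ring

lemma cross_smul_left (c : ℝ) (v w : ℝ × ℝ) : cross (c • v) w = c * cross v w := by
  simp only [cross, Prod.smul_fst, Prod.smul_snd, smul_eq_mul]; ring

lemma cross_add_right (u v w : ℝ × ℝ) : cross u (v + w) = cross u v + cross u w := by
  simp only [cross, Prod.fst_add, Prod.snd_add]; ring

lemma cross_add_left (u v w : ℝ × ℝ) : cross (u + v) w = cross u w + cross v w := by
  simp only [cross, Prod.fst_add, Prod.snd_add]; ring

/-- The argument of a vector of the plane. -/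
def planeArg (v : ℝ × ℝ) : ℝ := Complex.arg ⟨v.1, v.2⟩

lemma exists_eq_smul_dir_planeArg {v : ℝ × ℝ} (hv : v ≠ 0) :
    ∃ ρ : ℝ, 0 < ρ ∧ v = ρ • dir (planeArg v) := by
  refine ⟨‖(⟨v.1, v.2⟩ : ℂ)‖, ?_, ?_⟩
  · rw [norm_pos_iff]
    intro h
    apply hv
    rw [Complex.ext_iff] at h
    exact Prod.ext h.1 h.2
  · refine Prod.ext ?_ ?_
    · simp [dir, planeArg, Complex.norm_mul_cos_arg]
    · simp [dir, planeArg, Complex.norm_mul_sin_arg]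

/-- The intersection of two closed half-planes through `O`. -/
def sector (O : ℝ × ℝ) (α β : ℝ) : Set (ℝ × ℝ) :=
  {x | 0 ≤ cross (dir α) (x - O) ∧ 0 ≤ cross (x - O) (dir β)}

lemma measurableSet_sector (O : ℝ × ℝ) (α β : ℝ) : MeasurableSet (sector O α β) :=
  ((isClosed_le continuous_const (continuous_cross_left O _)).inter
    (isClosed_le continuous_const (continuous_cross_right O _))).measurableSet

lemma sin_two_pi_mul_int_add (m : ℤ) (τ : ℝ) : Real.sin (2 * Real.pi * m + τ) = Real.sin τ := by
  rw [show 2 * Real.pi * m + τ = τ + m * (2 * Real.pi) by ring, Real.sin_add_int_mul_two_pi]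

lemma exists_floor_decomp (y : ℝ) : ∃ τ : ℝ, 0 ≤ τ ∧ τ < 2 * Real.pi ∧
    y = 2 * Real.pi * ⌊y / (2 * Real.pi)⌋ + τ := by
  have hpi := Real.two_pi_pos
  refine ⟨y - 2 * Real.pi * ⌊y / (2 * Real.pi)⌋, ?_, ?_, by ring⟩
  · have := Int.floor_le (y / (2 * Real.pi))
    rw [le_div_iff₀ hpi] at this
    linarith
  · have := Int.lt_floor_add_one (y / (2 * Real.pi))
    rw [div_lt_iff₀ hpi] at this
    linarith

lemma wedge_eq_sector (O : ℝ × ℝ) {α β : ℝ} (h1 : α < β) (h2 : β ≤ α + Real.pi) :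
    Wedge O α β = sector O α β := by
  have hpi := Real.pi_pos
  ext x
  constructor
  · rintro (rfl | ⟨r, hr, θ, ⟨hθ1, hθ2⟩, rfl⟩)
    · simp [sector, cross]
    · change 0 ≤ cross (dir α) (O + r • dir θ - O) ∧ 0 ≤ cross (O + r • dir θ - O) (dir β)
      rw [add_sub_cancel_left, cross_smul_right, cross_smul_left, cross_dir_dir, cross_dir_dir]
      exact ⟨mul_nonneg hr.le (Real.sin_nonneg_of_nonneg_of_le_pi (by linarith) (by linarith)),
        mul_nonneg hr.le (Real.sin_nonneg_of_nonneg_of_le_pi (by linarith) (by linarith))⟩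
  · rintro ⟨hx1, hx2⟩
    by_cases hx : x = O
    · exact Or.inl hx
    right
    obtain ⟨ρ, hρ, hv⟩ := exists_eq_smul_dir_planeArg (sub_ne_zero.2 hx)
    set a := planeArg (x - O) with ha
    rw [hv, cross_smul_right, cross_dir_dir] at hx1
    rw [hv, cross_smul_left, cross_dir_dir] at hx2
    have hx1 := nonneg_of_mul_nonneg_right hx1 hρ
    have hx2 := nonneg_of_mul_nonneg_right hx2 hρ
    obtain ⟨τ, hτ0, hτ1, hτ⟩ := exists_floor_decomp (α - a)
    set m := ⌊(α - a) / (2 * Real.pi)⌋ with hm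
    rw [show a - α = -(2 * Real.pi * m + τ) by linarith, Real.sin_neg,
      sin_two_pi_mul_int_add] at hx1
    rw [show β - a = 2 * Real.pi * m + (τ + (β - α)) by linarith, sin_two_pi_mul_int_add] at hx2
    have hxO : ∀ k : ℤ, x = O + ρ • (Real.cos (a + k * (2 * Real.pi)),
        Real.sin (a + k * (2 * Real.pi))) := by
      intro k
      rw [Real.cos_add_int_mul_two_pi, Real.sin_add_int_mul_two_pi]
      change x = O + ρ • dir a
      rw [← hv]; abel
    rcases hτ0.eq_or_lt with h0 | h0
    · exact ⟨ρ, hρ, _, ⟨by linarith, by linarith⟩, hxO m⟩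
    · have hτπ : Real.pi ≤ τ := by
        by_contra hlt
        have := Real.sin_pos_of_pos_of_lt_pi h0 (by linarith)
        linarith
      have h3 : 2 * Real.pi ≤ τ + (β - α) := by
        by_contra hlt
        have := Real.sin_neg_of_neg_of_neg_pi_lt (x := τ + (β - α) - 2 * Real.pi) (by linarith)
          (by linarith)
        rw [Real.sin_sub_two_pi] at this
        linarith
      refine ⟨ρ, hρ, _, ⟨?_, ?_⟩, hxO (m + 1)⟩ <;> push_cast <;> linarith

lemma convex_sector (O : ℝ × ℝ) (α β : ℝ) : Convex ℝ (sector O α β) := by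
  intro x hx y hy a b ha hb hab
  have e : a • x + b • y - O = a • (x - O) + b • (y - O) := by
    obtain rfl : b = 1 - a := by linarith
    module
  simp only [sector, Set.mem_ofPred_eq] at hx hy ⊢
  rw [e, cross_add_right, cross_add_left, cross_smul_right, cross_smul_right, cross_smul_left,
    cross_smul_left]
  exact ⟨add_nonneg (mul_nonneg ha hx.1) (mul_nonneg hb hy.1),
    add_nonneg (mul_nonneg ha hx.2) (mul_nonneg hb hy.2)⟩

/-- The winding number counting function, whose integral is the cumulative angular
distribution. -/
def turns (O : ℝ × ℝ) (θ : ℝ) (x : ℝ × ℝ) : ℤ := ⌊(θ - planeArg (x - O)) / (2 * Real.pi)⌋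

lemma turns_sub_turns (O : ℝ × ℝ) {α β : ℝ} (h1 : α < β) (h2 : β ≤ α + Real.pi) {x : ℝ × ℝ}
    (hx : cross (dir α) (x - O) ≠ 0) :
    (turns O β x : ℝ) - turns O α x = (sector O α β).indicator 1 x := by
  have hpi := Real.pi_pos
  have hx0 : x - O ≠ 0 := by
    intro h
    rw [h] at hx
    simp [cross] at hx
  obtain ⟨ρ, hρ, hv⟩ := exists_eq_smul_dir_planeArg hx0
  unfold turns
  set a := planeArg (x - O) with ha
  obtain ⟨τ, hτ0, hτ1, hτ⟩ := exists_floor_decomp (α - a)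
  set m := ⌊(α - a) / (2 * Real.pi)⌋ with hm
  have c1 : cross (dir α) (x - O) = -(ρ * Real.sin τ) := by
    rw [hv, cross_smul_right, cross_dir_dir, show a - α = -(2 * Real.pi * m + τ) by linarith,
      Real.sin_neg, sin_two_pi_mul_int_add, mul_neg]
  have c2 : cross (x - O) (dir β) = ρ * Real.sin (τ + (β - α)) := by
    rw [hv, cross_smul_left, cross_dir_dir,
      show β - a = 2 * Real.pi * m + (τ + (β - α)) by linarith, sin_two_pi_mul_int_add]
  have hmem : x ∈ sector O α β ↔ Real.sin τ < 0 ∧ 0 ≤ Real.sin (τ + (β - α)) := by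
    simp only [sector, Set.mem_ofPred_eq]
    rw [c2, mul_nonneg_iff_of_pos_left hρ]
    rw [c1] at hx ⊢
    have hne : Real.sin τ ≠ 0 := by
      intro h
      simp [h] at hx
    refine and_congr_left fun _ => ?_
    constructor
    · intro h
      refine lt_of_le_of_ne ?_ hne
      by_contra hlt
      have := mul_pos hρ (not_le.1 hlt)
      linarith
    · intro h
      have := mul_neg_of_pos_of_neg hρ h
      linarith
  by_cases hc : τ + (β - α) < 2 * Real.pi
  · have hfl : ⌊(β - a) / (2 * Real.pi)⌋ = m := by
      rw [Int.floor_eq_iff, le_div_iff₀ (by linarith), div_lt_iff₀ (by linarith)]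
      constructor <;> linarith
    have hn : x ∉ sector O α β := by
      rw [hmem]
      rintro ⟨h3, h4⟩
      have hτπ : Real.pi < τ := by
        by_contra hlt
        have := Real.sin_nonneg_of_nonneg_of_le_pi hτ0 (not_lt.1 hlt)
        linarith
      have := Real.sin_neg_of_neg_of_neg_pi_lt (x := τ + (β - α) - 2 * Real.pi) (by linarith)
        (by linarith)
      rw [Real.sin_sub_two_pi] at this
      linarith
    rw [hfl, Set.indicator_of_notMem hn, sub_self]
  · have hfl : ⌊(β - a) / (2 * Real.pi)⌋ = m + 1 := by
      rw [Int.floor_eq_iff, le_div_iff₀ (by linarith), div_lt_iff₀ (by linarith)]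
      push_cast
      constructor <;> linarith
    have hτπ : Real.pi < τ := by
      rcases (show Real.pi ≤ τ by linarith).eq_or_lt with h | h
      · rw [c1, ← h] at hx
        simp at hx
      · exact h
    have hn : x ∈ sector O α β := by
      rw [hmem]
      constructor
      · have := Real.sin_neg_of_neg_of_neg_pi_lt (x := τ - 2 * Real.pi) (by linarith)
          (by linarith)
        rwa [Real.sin_sub_two_pi] at this
      · have := Real.sin_nonneg_of_nonneg_of_le_pi (x := τ + (β - α) - 2 * Real.pi) (by linarith)
          (by linarith)
        rwa [Real.sin_sub_two_pi] at this
    rw [hfl, Set.indicator_of_mem hn]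
    simp

lemma turns_add_two_pi (O : ℝ × ℝ) (θ : ℝ) (x : ℝ × ℝ) :
    turns O (θ + 2 * Real.pi) x = turns O θ x + 1 := by
  have hpi := Real.two_pi_pos
  unfold turns
  rw [← Int.floor_add_one]
  congr 1
  field_simp
  ring

lemma turns_mono (O : ℝ × ℝ) (x : ℝ × ℝ) : Monotone fun θ => turns O θ x := by
  have hpi := Real.two_pi_pos
  intro a b hab
  refine Int.floor_mono ?_
  gcongr

lemma abs_turns_le (O : ℝ × ℝ) (θ : ℝ) (x : ℝ × ℝ) : |(turns O θ x : ℝ)| ≤ |θ| + 2 := by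
  have hpi := Real.pi_gt_three
  have h1 : |planeArg (x - O)| ≤ Real.pi := Complex.abs_arg_le_pi _
  have h2 := Int.floor_le ((θ - planeArg (x - O)) / (2 * Real.pi))
  have h3 := Int.lt_floor_add_one ((θ - planeArg (x - O)) / (2 * Real.pi))
  rw [le_div_iff₀ (by linarith)] at h2
  rw [div_lt_iff₀ (by linarith)] at h3
  change (turns O θ x : ℝ) * _ ≤ _ at h2
  change _ < ((turns O θ x : ℝ) + 1) * _ at h3
  rw [abs_le] at h1
  have h4 := le_abs_self θ
  have h5 := neg_abs_le θ
  have h6 := abs_nonneg θ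
  rw [abs_le]
  constructor
  · by_contra hlt
    push Not at hlt
    nlinarith
  · by_contra hlt
    push Not at hlt
    nlinarith

lemma measurable_planeArg : Measurable planeArg := by
  have : Measurable fun v : ℝ × ℝ => Complex.measurableEquivRealProd.symm v :=
    Complex.measurableEquivRealProd.symm.measurable
  exact Complex.measurable_arg.comp this

lemma measurable_turns (O : ℝ × ℝ) (θ : ℝ) : Measurable fun x => (turns O θ x : ℝ) := by
  have h : Measurable fun x => (θ - planeArg (x - O)) / (2 * Real.pi) :=
    ((measurable_const.sub (measurable_planeArg.comp (measurable_id.sub_const O))).div_const _)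
  exact measurable_from_top.comp (Int.measurable_floor.comp h)

lemma continuousAt_intCast_floor {y : ℝ} (hy : ∀ n : ℤ, y ≠ n) :
    ContinuousAt (fun y : ℝ => ((⌊y⌋ : ℤ) : ℝ)) y := by
  have h1 : (⌊y⌋ : ℝ) < y := lt_of_le_of_ne (Int.floor_le y) (hy _).symm
  have h2 := Int.lt_floor_add_one y
  have : (fun z : ℝ => ((⌊z⌋ : ℤ) : ℝ)) =ᶠ[nhds y] fun _ => (⌊y⌋ : ℝ) := by
    filter_upwards [Ioo_mem_nhds h1 h2] with z hz
    rw [Int.floor_eq_iff.2 ⟨hz.1.le, hz.2⟩]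
  exact this.continuousAt

lemma continuousAt_turns {O : ℝ × ℝ} {θ : ℝ} {x : ℝ × ℝ} (h1 : cross (dir θ) (x - O) ≠ 0)
    (h2 : cross (dir 0) (x - O) ≠ 0) :
    ContinuousAt (fun z : (ℝ × ℝ) × ℝ => (turns z.1 z.2 x : ℝ)) (O, θ) := by
  have hpi := Real.two_pi_pos
  have hx0 : x - O ≠ 0 := by
    intro h
    rw [h] at h1
    simp [cross] at h1
  have harg : ContinuousAt (fun z : (ℝ × ℝ) × ℝ => planeArg (x - z.1)) (O, θ) := by
    have hs : (⟨(x - O).1, (x - O).2⟩ : ℂ) ∈ Complex.slitPlane := by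
      right
      simpa [cross, dir] using h2
    have hc : Continuous fun z : (ℝ × ℝ) × ℝ => Complex.equivRealProdCLM.symm (x - z.1) := by
      fun_prop
    exact ContinuousAt.comp (f := fun z : (ℝ × ℝ) × ℝ => Complex.equivRealProdCLM.symm (x - z.1))
      (Complex.continuousAt_arg hs) hc.continuousAt
  have hq : ContinuousAt (fun z : (ℝ × ℝ) × ℝ => (z.2 - planeArg (x - z.1)) / (2 * Real.pi))
      (O, θ) := (continuousAt_snd.sub harg).div_const _
  refine ContinuousAt.comp (g := fun y : ℝ => ((⌊y⌋ : ℤ) : ℝ)) (continuousAt_intCast_floor ?_) hq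
  intro n hn
  obtain ⟨ρ, hρ, hv⟩ := exists_eq_smul_dir_planeArg hx0
  apply h1
  simp only at hn
  rw [div_eq_iff hpi.ne'] at hn
  rw [hv, cross_smul_right, cross_dir_dir,
    show planeArg (x - O) - θ = -(2 * Real.pi * n + 0) by linarith, Real.sin_neg,
    sin_two_pi_mul_int_add]
  simp
lemma IsMass.measure_cross_eq_zero {μ : Measure (ℝ × ℝ)} (hμ : IsMass μ) (O : ℝ × ℝ) (θ : ℝ) :
    μ {x | cross (dir θ) (x - O) = 0} = 0 := by
  refine measure_mono_null ?_ (hμ.2 {x | ∃ t : ℝ, x = O + t • dir θ} ⟨O, dir θ, ?_, rfl⟩)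
  · intro x hx
    refine ⟨(dir θ).1 * (x - O).1 + (dir θ).2 * (x - O).2, ?_⟩
    have h := Real.sin_sq_add_cos_sq θ
    simp only [Set.mem_ofPred_eq, cross, dir, Prod.fst_sub, Prod.snd_sub] at hx
    refine Prod.ext ?_ ?_
    · simp only [dir, Prod.fst_add, Prod.smul_fst, smul_eq_mul, Prod.fst_sub, Prod.snd_sub]
      linear_combination -(x.1 - O.1) * h - Real.sin θ * hx
    · simp only [dir, Prod.snd_add, Prod.smul_snd, smul_eq_mul, Prod.fst_sub, Prod.snd_sub]
      linear_combination -(x.2 - O.2) * h + Real.cos θ * hx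
  · intro h
    have h1 : Real.cos θ = 0 := congrArg Prod.fst h
    have h2 : Real.sin θ = 0 := congrArg Prod.snd h
    have := Real.sin_sq_add_cos_sq θ
    rw [h1, h2] at this
    norm_num at this

/-- The cumulative angular distribution of `μ` around `O`. -/
def radialCDF (μ : Measure (ℝ × ℝ)) (O : ℝ × ℝ) (θ : ℝ) : ℝ := ∫ x, (turns O θ x : ℝ) ∂μ

lemma integrable_turns (μ : Measure (ℝ × ℝ)) [IsFiniteMeasure μ] (O : ℝ × ℝ) (θ : ℝ) :
    Integrable (fun x => (turns O θ x : ℝ)) μ :=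
  Integrable.of_bound (measurable_turns O θ).aestronglyMeasurable (|θ| + 2)
    (Filter.Eventually.of_forall fun x => abs_turns_le O θ x)

lemma continuous_radialCDF {μ : Measure (ℝ × ℝ)} (hμ : IsMass μ) :
    Continuous fun z : (ℝ × ℝ) × ℝ => radialCDF μ z.1 z.2 := by
  have := hμ.1
  rw [continuous_iff_continuousAt]
  rintro ⟨O, θ⟩
  refine continuousAt_of_dominated (bound := fun _ => |θ| + 1 + 2) ?_ ?_ (integrable_const _) ?_
  · exact Filter.Eventually.of_forall fun z => (measurable_turns z.1 z.2).aestronglyMeasurable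
  · have h1 : ∀ᶠ z : (ℝ × ℝ) × ℝ in nhds (O, θ), |z.2| < |θ| + 1 :=
      (continuous_snd.abs.continuousAt).eventually_lt continuousAt_const (by simp)
    filter_upwards [h1] with z hz
    refine Filter.Eventually.of_forall fun x => ?_
    exact (abs_turns_le z.1 z.2 x).trans (by linarith)
  · have h1 : ∀ᵐ x ∂μ, cross (dir θ) (x - O) ≠ 0 := by
      rw [ae_iff]; simpa using hμ.measure_cross_eq_zero O θ
    have h2 : ∀ᵐ x ∂μ, cross (dir 0) (x - O) ≠ 0 := by
      rw [ae_iff]; simpa using hμ.measure_cross_eq_zero O 0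
    filter_upwards [h1, h2] with x hx1 hx2
    exact continuousAt_turns hx1 hx2

lemma radialCDF_mono (μ : Measure (ℝ × ℝ)) [IsFiniteMeasure μ] (O : ℝ × ℝ) :
    Monotone (radialCDF μ O) := by
  intro a b hab
  refine integral_mono (integrable_turns μ O a) (integrable_turns μ O b) fun x => ?_
  exact Int.cast_le.2 (turns_mono O x hab)

lemma radialCDF_add_two_pi (μ : Measure (ℝ × ℝ)) [IsProbabilityMeasure μ] (O : ℝ × ℝ) (θ : ℝ) :
    radialCDF μ O (θ + 2 * Real.pi) = radialCDF μ O θ + 1 := by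
  unfold radialCDF
  simp only [turns_add_two_pi, Int.cast_add, Int.cast_one]
  rw [integral_add (integrable_turns μ O θ) (integrable_const _)]
  simp

lemma radialCDF_sub {μ : Measure (ℝ × ℝ)} (hμ : IsMass μ) (O : ℝ × ℝ) {α β : ℝ} (h1 : α < β)
    (h2 : β ≤ α + Real.pi) : radialCDF μ O β - radialCDF μ O α = μ.real (sector O α β) := by
  have := hμ.1
  unfold radialCDF
  rw [← integral_sub (integrable_turns μ O β) (integrable_turns μ O α),
    ← integral_indicator_one (measurableSet_sector O α β)]
  refine integral_congr_ae ?_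
  have h3 : ∀ᵐ x ∂μ, cross (dir α) (x - O) ≠ 0 := by
    rw [ae_iff]; simpa using hμ.measure_cross_eq_zero O α
  filter_upwards [h3] with x hx
  exact turns_sub_turns O h1 h2 hx

lemma cross_dir_eq (t : ℝ) (v : ℝ × ℝ) :
    cross (dir t) v = (dir (t + Real.pi / 2)).1 * v.1 + (dir (t + Real.pi / 2)).2 * v.2 := by
  simp only [cross, dir, Real.cos_add_pi_div_two, Real.sin_add_pi_div_two]; ring

lemma sector_add_pi (O : ℝ × ℝ) (t : ℝ) :
    sector O t (t + Real.pi) = {x | 0 ≤ cross (dir t) (x - O)} := by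
  ext x
  have : cross (x - O) (dir (t + Real.pi)) = cross (dir t) (x - O) := by
    rw [dir_add_pi]; simp only [cross, Prod.fst_neg, Prod.snd_neg]; ring
  simp [sector, this]

lemma radialCDF_tail {μ : Measure (ℝ × ℝ)} (hμ : IsMass μ) {ε : ℝ} (hε : 0 < ε) :
    ∃ R : ℝ, ∀ (O : ℝ × ℝ) (t : ℝ),
      R ≤ (dir (t + Real.pi / 2)).1 * O.1 + (dir (t + Real.pi / 2)).2 * O.2 →
        radialCDF μ O (t + Real.pi) - radialCDF μ O t < ε := by
  have := hμ.1
  have hpi := Real.pi_pos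
  have hlim : Filter.Tendsto (fun n : ℕ => μ.real (Metric.closedBall (0 : ℝ × ℝ) n)) Filter.atTop
      (nhds 1) := by
    have hmono : Monotone fun n : ℕ => Metric.closedBall (0 : ℝ × ℝ) n := fun a b hab =>
      Metric.closedBall_subset_closedBall (by exact_mod_cast hab)
    have h := tendsto_measure_iUnion_atTop (μ := μ) hmono
    rw [Metric.iUnion_closedBall_nat, measure_univ] at h
    exact (ENNReal.tendsto_toReal ENNReal.one_ne_top).comp h
  obtain ⟨n, hn⟩ := (hlim.eventually_const_lt (show 1 - ε < 1 by linarith)).exists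
  refine ⟨2 * n + 1, fun O t hO => ?_⟩
  rw [radialCDF_sub hμ O (by linarith) le_rfl, sector_add_pi]
  have hsub : {x | 0 ≤ cross (dir t) (x - O)} ⊆ (Metric.closedBall (0 : ℝ × ℝ) n)ᶜ := by
    intro x hx hxn
    rw [mem_closedBall_zero_iff, Prod.norm_def, max_le_iff, Real.norm_eq_abs, Real.norm_eq_abs,
      abs_le, abs_le] at hxn
    simp only [Set.mem_ofPred_eq, cross_dir_eq, Prod.fst_sub, Prod.snd_sub] at hx
    have b1 := Real.cos_le_one (t + Real.pi / 2)
    have b2 := Real.neg_one_le_cos (t + Real.pi / 2)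
    have b3 := Real.sin_le_one (t + Real.pi / 2)
    have b4 := Real.neg_one_le_sin (t + Real.pi / 2)
    simp only [dir] at hx hO
    have h1 : Real.cos (t + Real.pi / 2) * x.1 ≤ n := by
      nlinarith
    have h2 : Real.sin (t + Real.pi / 2) * x.2 ≤ n := by
      nlinarith
    linarith
  have h1 := measureReal_mono (μ := μ) hsub
  rw [probReal_compl_eq_one_sub Metric.isClosed_closedBall.measurableSet] at h1
  linarith

lemma exists_norm_le_of_le_radialCDF {μ : Measure (ℝ × ℝ)} (hμ : IsMass μ) {ε : ℝ} (hε : 0 < ε) :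
    ∃ R : ℝ, ∀ O : ℝ × ℝ,
      (∀ t, ε ≤ radialCDF μ O (t + Real.pi) - radialCDF μ O t) → ‖O‖ ≤ R := by
  obtain ⟨R, hR⟩ := radialCDF_tail hμ hε
  refine ⟨max R 0, fun O hO => ?_⟩
  by_cases h0 : O = 0
  · rw [h0, norm_zero]; exact le_max_right _ _
  obtain ⟨ρ, hρ, hv⟩ := exists_eq_smul_dir_planeArg h0
  have h1 : ρ < R := by
    by_contra hlt
    have := hR O (planeArg O - Real.pi / 2) (by
      rw [sub_add_cancel]
      have := IsRadialCDF.dir_dot_self (planeArg O) ρ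
      rw [← hv] at this
      linarith)
    have := hO (planeArg O - Real.pi / 2)
    linarith
  refine le_trans ?_ (h1.le.trans (le_max_left _ _))
  rw [hv, norm_smul, Real.norm_of_nonneg hρ.le]
  refine mul_le_of_le_one_right hρ.le ?_
  rw [Prod.norm_def]
  exact max_le (Real.abs_cos_le_one _) (Real.abs_sin_le_one _)

lemma measureReal_lt_of_isOpen {μ : Measure (ℝ × ℝ)} [IsFiniteMeasure μ] [μ.IsOpenPosMeasure]
    {A B V : Set (ℝ × ℝ)} (hA : MeasurableSet A) (hAB : A ⊆ B) (hV : IsOpen V)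
    (hne : V.Nonempty) (hVB : V ⊆ B \ A) : μ.real A < μ.real B := by
  have h1 : 0 < μ.real V := ENNReal.toReal_pos (hV.measure_pos μ hne).ne' (measure_ne_top _ _)
  have h2 := measureReal_mono (μ := μ) hVB
  have h3 := measureReal_sdiff_add_inter (μ := μ) (s := B) hA
  rw [Set.inter_eq_self_of_subset_right hAB] at h3
  linarith

lemma cross_dir_self (t : ℝ) : cross (dir t) (dir t) = 0 := by
  rw [cross_dir_dir]; simp

lemma sub_add_smul_dir (x O : ℝ × ℝ) (δ t : ℝ) :
    x - (O + δ • dir t) = x - O + (-δ) • dir t := by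
  module

theorem isRadialCDF_radialCDF {μ : Measure (ℝ × ℝ)} (hμ : IsMass μ) [μ.IsOpenPosMeasure] :
    IsRadialCDF (radialCDF μ) := by
  have := hμ.1
  have hpi := Real.pi_pos
  refine ⟨continuous_radialCDF hμ, ?_, radialCDF_add_two_pi μ, ?_, ?_, ?_,
    fun ε hε => radialCDF_tail hμ hε⟩
  · intro O α β hαβ
    set γ := min β (α + Real.pi / 2) with hγ
    have h1 : α < γ := lt_min hαβ (by linarith)
    have h2 : γ ≤ α + Real.pi / 2 := min_le_right _ _
    have h3 := radialCDF_mono μ O (min_le_left β (α + Real.pi / 2))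
    have h4 := radialCDF_sub hμ O h1 (by linarith)
    have hs : 0 < Real.sin (γ - α) := Real.sin_pos_of_pos_of_lt_pi (by linarith) (by linarith)
    have h5 : μ.real ∅ < μ.real (sector O α γ) := by
      refine measureReal_lt_of_isOpen (V := {x | 0 < cross (dir α) (x - O)} ∩
        {x | 0 < cross (x - O) (dir γ)}) MeasurableSet.empty (Set.empty_subset _)
        ((isOpen_lt continuous_const (continuous_cross_left O _)).inter
          (isOpen_lt continuous_const (continuous_cross_right O _)))
        ⟨O + (dir α + dir γ), ?_, ?_⟩ ?_
      · rw [Set.mem_ofPred_eq, add_sub_cancel_left, cross_add_right, cross_dir_self, cross_dir_dir]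
        linarith
      · rw [Set.mem_ofPred_eq, add_sub_cancel_left, cross_add_left, cross_dir_self, cross_dir_dir]
        linarith
      · rintro x ⟨hx1, hx2⟩
        exact ⟨⟨le_of_lt hx1, le_of_lt hx2⟩, Set.notMem_empty x⟩
    rw [measureReal_empty] at h5
    linarith
  · intro O t δ φ hδ h1 h2
    have hs : 0 < Real.sin (φ - t) := Real.sin_pos_of_pos_of_lt_pi (by linarith) (by linarith)
    have hδs := mul_pos hδ hs
    rw [radialCDF_sub hμ _ h1 h2.le, radialCDF_sub hμ _ h1 h2.le]
    have e1 : ∀ x, cross (dir t) (x - (O + δ • dir t)) = cross (dir t) (x - O) := by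
      intro x
      rw [sub_add_smul_dir, cross_add_right, cross_smul_right, cross_dir_self, mul_zero, add_zero]
    have e2 : ∀ x, cross (x - (O + δ • dir t)) (dir φ)
        = cross (x - O) (dir φ) - δ * Real.sin (φ - t) := by
      intro x
      rw [sub_add_smul_dir, cross_add_left, cross_smul_left, cross_dir_dir]
      ring
    refine measureReal_lt_of_isOpen (V := {x | 0 < cross (dir t) (x - O)} ∩
        ({x | 0 < cross (x - O) (dir φ)} ∩ {x | cross (x - O) (dir φ) < δ * Real.sin (φ - t)}))
        (measurableSet_sector _ _ _) ?_
        ((isOpen_lt continuous_const (continuous_cross_left O _)).inter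
          ((isOpen_lt continuous_const (continuous_cross_right O _)).inter
            (isOpen_lt (continuous_cross_right O _) continuous_const)))
        ⟨O + ((δ / 2) • dir t + dir φ), ?_, ?_, ?_⟩ ?_
    · rintro x ⟨hx1, hx2⟩
      rw [e1] at hx1
      rw [e2] at hx2
      exact ⟨hx1, by linarith⟩
    · rw [Set.mem_ofPred_eq, add_sub_cancel_left, cross_add_right, cross_smul_right,
        cross_dir_self, cross_dir_dir]
      linarith
    · rw [Set.mem_ofPred_eq, add_sub_cancel_left, cross_add_left, cross_smul_left,
        cross_dir_self, cross_dir_dir]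
      linarith
    · rw [Set.mem_ofPred_eq, add_sub_cancel_left, cross_add_left, cross_smul_left,
        cross_dir_self, cross_dir_dir]
      linarith
    · rintro x ⟨hx1, hx2, hx3⟩
      refine ⟨⟨le_of_lt hx1, le_of_lt hx2⟩, fun hx => ?_⟩
      have h4 := hx.2
      rw [e2] at h4
      rw [Set.mem_ofPred_eq] at hx3
      linarith
  · intro O t δ
    rw [radialCDF_sub hμ _ (by linarith) le_rfl, radialCDF_sub hμ _ (by linarith) le_rfl,
      sector_add_pi, sector_add_pi]
    congr 1
    ext x
    rw [Set.mem_ofPred_eq, Set.mem_ofPred_eq, sub_add_smul_dir, cross_add_right, cross_smul_right,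
      cross_dir_self, mul_zero, add_zero]
  · intro O t δ hδ
    have e : ∀ x, cross (dir t) (x - (O + δ • dir (t + Real.pi / 2)))
        = cross (dir t) (x - O) - δ := by
      intro x
      rw [sub_add_smul_dir, cross_add_right, cross_smul_right, cross_dir_dir, add_sub_cancel_left,
        Real.sin_pi_div_two]
      ring
    have e0 : cross (dir t) (dir (t + Real.pi / 2)) = 1 := by
      rw [cross_dir_dir, add_sub_cancel_left, Real.sin_pi_div_two]
    rw [radialCDF_sub hμ _ (by linarith) le_rfl, radialCDF_sub hμ _ (by linarith) le_rfl]
    refine measureReal_lt_of_isOpen (V := {x | 0 < cross (dir t) (x - O)} ∩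
        {x | cross (dir t) (x - O) < δ}) (measurableSet_sector _ _ _) ?_
        ((isOpen_lt continuous_const (continuous_cross_left O _)).inter
            (isOpen_lt (continuous_cross_left O _) continuous_const))
        ⟨O + (δ / 2) • dir (t + Real.pi / 2), ?_, ?_⟩ ?_
    · rw [sector_add_pi, sector_add_pi]
      intro x hx
      rw [Set.mem_ofPred_eq, e] at hx
      rw [Set.mem_ofPred_eq]
      linarith
    · rw [Set.mem_ofPred_eq, add_sub_cancel_left, cross_smul_right, e0]
      linarith
    · rw [Set.mem_ofPred_eq, add_sub_cancel_left, cross_smul_right, e0]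
      linarith
    · rw [sector_add_pi, sector_add_pi]
      rintro x ⟨hx1, hx2⟩
      rw [Set.mem_ofPred_eq] at hx1
      refine ⟨Set.mem_ofPred_eq.mpr hx1.le, fun hx => ?_⟩
      rw [Set.mem_ofPred_eq, e] at hx
      rw [Set.mem_ofPred_eq] at hx2
      linarith

/-- An equipartition with angles normalized so that they are bounded, together with a lower bound
for the mass of the half-planes bounded by a line through its apex. -/
lemma IsRadialCDF.exists_bounded_equipartition {F : ℝ × ℝ → ℝ → ℝ} (hF : IsRadialCDF F) (m : ℤ)
    (hm : 1 ≤ m) :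
    ∃ (O : ℝ × ℝ) (θ : ℤ → ℝ),
      (∀ k, θ (k + 6 * m) = θ k + 2 * Real.pi) ∧
      Monotone θ ∧
      (∀ k l, F O (θ (k + l)) = F O (θ k) + l / (6 * m)) ∧
      (∀ k, θ (k + (2 * m + 1)) - θ k ≤ Real.pi) ∧
      (∀ k, |θ k| ≤ 2 * Real.pi * (|(k : ℝ)| + 1)) ∧
      (∀ t, 1 / 3 ≤ F O (t + Real.pi) - F O t) := by
  have hpi := Real.two_pi_pos
  have hm' : (1 : ℝ) ≤ m := by exact_mod_cast hm
  obtain ⟨O, θ, hp, hmono, hFθ, hle⟩ := hF.exists_equipartition m hm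
  have hpz : ∀ k z : ℤ, θ (k + 6 * m * z) = θ k + 2 * Real.pi * z := by
    have hper : Function.Periodic (fun k : ℤ => θ k - k * (2 * Real.pi / (6 * m))) (6 * m) := by
      intro k
      simp only [hp]
      push_cast
      field_simp
      ring
    intro k z
    have := hper.zsmul z k
    simp only [smul_eq_mul] at this
    rw [mul_comm z] at this
    push_cast at this
    have e : ((k : ℝ) + 6 * m * z) * (2 * Real.pi / (6 * m))
      = k * (2 * Real.pi / (6 * m)) + 2 * Real.pi * z := by field_simp
    rw [e] at this
    linarith
  have hFθ' : ∀ k l, F O (θ (k + l)) = F O (θ k) + l / (6 * m) := by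
    intro k l
    rw [hFθ, hFθ k]
    push_cast
    ring
  obtain ⟨τ, hτ0, hτ1, hτ⟩ := exists_floor_decomp (θ 0)
  set a : ℤ := 6 * m * (-⌊θ 0 / (2 * Real.pi)⌋) with ha
  have hθa : θ a = τ := by
    have := hpz 0 (-⌊θ 0 / (2 * Real.pi)⌋)
    rw [zero_add] at this
    rw [ha, this]
    push_cast
    linarith
  refine ⟨O, fun k => θ (a + k), ?_, ?_, ?_, ?_, ?_, ?_⟩
  · intro k
    beta_reduce
    rw [← add_assoc, hp]
  · intro k l hkl
    exact hmono.monotone (by omega)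
  · intro k l
    beta_reduce
    rw [← add_assoc, hFθ']
  · intro k
    beta_reduce
    rw [← add_assoc a k]
    linarith [hle (a + k)]
  · intro k
    have hk : |k| ≤ 6 * m * |k| := le_mul_of_one_le_left (abs_nonneg k) (by omega)
    have h1 := hmono.monotone (show a + k ≤ a + 6 * m * |k| by linarith [le_abs_self k])
    have h2 := hmono.monotone (show a + 6 * m * (-|k|) ≤ a + k by linarith [neg_abs_le k])
    rw [hpz, hθa] at h1 h2
    push_cast at h1 h2
    rw [abs_le]
    constructor <;> linarith
  · intro t
    set i : ℤ := ⌊(F O t - F O (θ 0)) * (6 * m)⌋ with hi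
    have h1 := Int.floor_le ((F O t - F O (θ 0)) * (6 * m))
    have h2 := Int.lt_floor_add_one ((F O t - F O (θ 0)) * (6 * m))
    rw [← hi] at h1 h2
    rw [← div_le_iff₀ (by linarith)] at h1
    rw [← lt_div_iff₀ (by linarith)] at h2
    have h3 : F O t < F O (θ (i + 1)) := by
      rw [hFθ (i + 1)]
      push_cast
      linarith
    have h4 : θ i ≤ t := by
      apply (hF.mono O).le_iff_le.1
      rw [hFθ i]
      linarith
    have h5 : F O (θ (i + (2 * m + 1))) ≤ F O (t + Real.pi) :=
      (hF.mono O).monotone (by linarith [hle i])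
    rw [hFθ] at h5
    rw [hFθ (i + 1)] at h3
    have e : ((i + (2 * m + 1) : ℤ) : ℝ) / (6 * m) = ((i + 1 : ℤ) : ℝ) / (6 * m) + 1 / 3 := by
      push_cast
      field_simp
      ring
    have h6 : F O t < F O (θ 0) + (i + 1) / (6 * m) := by linarith
    rw [e] at h5
    push_cast at h5
    linarith

lemma IsMass.mix {μ ν : Measure (ℝ × ℝ)} (hμ : IsMass μ) (hν : IsMass ν) {a b : ENNReal}
    (hab : a + b = 1) : IsMass (a • μ + b • ν) := by
  have := hμ.1
  have := hν.1
  refine ⟨⟨by simp [hab]⟩, fun L hL => ?_⟩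
  simp [hμ.2 L hL, hν.2 L hL]

lemma radialCDF_mix (μ ν : Measure (ℝ × ℝ)) [IsFiniteMeasure μ] [IsFiniteMeasure ν] {c : ℝ}
    (h0 : 0 ≤ c) (h1 : c ≤ 1) (O : ℝ × ℝ) (θ : ℝ) :
    radialCDF (ENNReal.ofReal (1 - c) • μ + ENNReal.ofReal c • ν) O θ
      = (1 - c) * radialCDF μ O θ + c * radialCDF ν O θ := by
  unfold radialCDF
  rw [integral_add_measure ((integrable_turns μ O θ).smul_measure ENNReal.ofReal_ne_top)
    ((integrable_turns ν O θ).smul_measure ENNReal.ofReal_ne_top), integral_smul_measure,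
    integral_smul_measure, ENNReal.toReal_ofReal (by linarith), ENNReal.toReal_ofReal h0]
  rfl

lemma isMass_toFinite_volume : IsMass (volume : Measure (ℝ × ℝ)).toFinite := by
  refine ⟨inferInstance, ?_⟩
  rintro L ⟨a, b, hb, rfl⟩
  apply toFinite_absolutelyContinuous
  have h1 : {x : ℝ × ℝ | ∃ t : ℝ, x = a + t • b}
      = (fun x => -a + x) ⁻¹' (Submodule.span ℝ {b} : Set (ℝ × ℝ)) := by
    ext x
    simp only [Set.mem_preimage, SetLike.mem_coe, Submodule.mem_span_singleton, Set.mem_ofPred_eq]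
    refine exists_congr fun t => ?_
    rw [eq_neg_add_iff_add_eq, eq_comm]
  rw [h1, measure_preimage_add]
  refine Measure.addHaar_submodule _ _ fun h => ?_
  have h2 := finrank_span_singleton (K := ℝ) hb
  rw [h, finrank_top, Module.finrank_prod] at h2
  simp at h2

instance isOpenPosMeasure_toFinite_volume :
    (volume : Measure (ℝ × ℝ)).toFinite.IsOpenPosMeasure :=
  (absolutelyContinuous_toFinite (volume : Measure (ℝ × ℝ))).isOpenPosMeasure

lemma exists_tendsto_of_norm_le {E : Type*} [NormedAddCommGroup E] [NormedSpace ℝ E]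
    [FiniteDimensional ℝ E] {ι : Type*} (f : Ultrafilter ι) {u : ι → E} {R : ℝ}
    (hu : ∀ i, ‖u i‖ ≤ R) : ∃ a, Filter.Tendsto u f (nhds a) := by
  have := FiniteDimensional.proper_real E
  obtain ⟨a, -, ha⟩ := (isCompact_closedBall (0 : E) R).ultrafilter_le_nhds (f.map u) (by
    rw [Filter.le_principal_iff]
    exact Filter.Eventually.of_forall (f := (f : Filter ι)) fun i => by
      simpa using hu i)
  exact ⟨a, ha⟩

/-- Every mass admits a fan of `6m` rays cutting it into equal parts such that any `2m + 1`
consecutive parts span an angle of at most `π`. -/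
theorem IsMass.exists_equipartition {μ : Measure (ℝ × ℝ)} (hμ : IsMass μ) (m : ℤ) (hm : 1 ≤ m) :
    ∃ (O : ℝ × ℝ) (θ : ℤ → ℝ),
      (∀ k, θ (k + 6 * m) = θ k + 2 * Real.pi) ∧
      Monotone θ ∧
      (∀ k l, radialCDF μ O (θ (k + l)) = radialCDF μ O (θ k) + l / (6 * m)) ∧
      (∀ k, θ (k + (2 * m + 1)) - θ k ≤ Real.pi) := by
  have hprob := hμ.1
  set ν := (volume : Measure (ℝ × ℝ)).toFinite with hν
  have hνm : IsMass ν := isMass_toFinite_volume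
  have hpi := Real.pi_pos
  set c : ℕ → ℝ := fun n => 1 / ((n : ℝ) + 6) with hc
  have hc0 : ∀ n, 0 < c n := fun n => by simp only [hc]; positivity
  have hc1 : ∀ n, c n ≤ 1 / 6 := fun n => by
    simp only [hc]
    gcongr
    linarith [Nat.cast_nonneg (α := ℝ) n]
  have hlim : Filter.Tendsto c Filter.atTop (nhds 0) := by
    have := (tendsto_natCast_atTop_atTop (R := ℝ)).atTop_add
      (tendsto_const_nhds (x := (6 : ℝ)))
    simp only [hc, one_div]
    exact this.inv_tendsto_atTop
  set M : ℕ → Measure (ℝ × ℝ) := fun n =>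
    ENNReal.ofReal (1 - c n) • μ + ENNReal.ofReal (c n) • ν with hM
  have hMcdf : ∀ n O θ, radialCDF (M n) O θ
      = (1 - c n) * radialCDF μ O θ + c n * radialCDF ν O θ := fun n O θ =>
    radialCDF_mix μ ν (hc0 n).le ((hc1 n).trans (by norm_num)) O θ
  have hMF : ∀ n, IsRadialCDF (radialCDF (M n)) := by
    intro n
    have h1 : IsMass (M n) := hμ.mix hνm (by
      rw [← ENNReal.ofReal_add (by linarith [hc1 n]) (hc0 n).le]
      simp)
    have : (M n).IsOpenPosMeasure := ⟨fun U hU hne h => by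
      have h2 : ENNReal.ofReal (c n) * ν U = 0 := by
        simp only [hM, Measure.coe_add, Measure.coe_smul, Pi.add_apply, Pi.smul_apply,
          smul_eq_mul, add_eq_zero] at h
        exact h.2
      rcases mul_eq_zero.1 h2 with h3 | h3
      · rw [ENNReal.ofReal_eq_zero] at h3
        linarith [hc0 n]
      · exact (hU.measure_pos ν hne).ne' h3⟩
    exact isRadialCDF_radialCDF h1
  choose O θ hp hmono hF hle hbd hhalf using fun n => (hMF n).exists_bounded_equipartition m hm
  obtain ⟨R, hR⟩ := exists_norm_le_of_le_radialCDF hμ (show (0 : ℝ) < 1 / 6 by norm_num)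
  have hOR : ∀ n, ‖O n‖ ≤ R := by
    intro n
    refine hR (O n) fun t => ?_
    have h1 := hhalf n t
    rw [hMcdf, hMcdf] at h1
    have h2 := radialCDF_mono ν (O n) (show t + Real.pi ≤ t + 2 * Real.pi by linarith)
    rw [radialCDF_add_two_pi] at h2
    have h3 := radialCDF_mono μ (O n) (show t ≤ t + Real.pi by linarith)
    nlinarith [hc0 n, hc1 n]
  set f := Filter.hyperfilter ℕ
  obtain ⟨P, hP⟩ := exists_tendsto_of_norm_le f hOR
  choose φ hφ using fun k : ℤ => exists_tendsto_of_norm_le f (u := fun n => θ n k)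
    (R := 2 * Real.pi * (|(k : ℝ)| + 1)) (fun n => by rw [Real.norm_eq_abs]; exact hbd n k)
  have hcf : Filter.Tendsto c f (nhds 0) := hlim.mono_left Nat.hyperfilter_le_atTop
  have hlimF : ∀ k, Filter.Tendsto (fun n => radialCDF (M n) (O n) (θ n k)) f
      (nhds (radialCDF μ P (φ k))) := by
    intro k
    simp only [hMcdf]
    have h1 := ((continuous_radialCDF hμ).tendsto (P, φ k)).comp (hP.prodMk_nhds (hφ k))
    have h2 := ((continuous_radialCDF hνm).tendsto (P, φ k)).comp (hP.prodMk_nhds (hφ k))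
    have h3 := ((tendsto_const_nhds (x := (1 : ℝ))).sub hcf).mul h1 |>.add (hcf.mul h2)
    simpa using h3
  refine ⟨P, φ, ?_, ?_, ?_, ?_⟩
  · intro k
    refine tendsto_nhds_unique (hφ (k + 6 * m)) ?_
    simp only [hp]
    exact (hφ k).add_const _
  · intro k l hkl
    exact le_of_tendsto_of_tendsto (hφ k) (hφ l) (Filter.Eventually.of_forall fun n => hmono n hkl)
  · intro k l
    refine tendsto_nhds_unique (hlimF (k + l)) ?_
    simp only [hF]
    exact (hlimF k).add_const _
  · intro k
    exact le_of_tendsto ((hφ (k + (2 * m + 1))).sub (hφ k))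
      (Filter.Eventually.of_forall fun n => hle n k)

/-- If `p ≥ 3` is odd, `q = 3p - 3` and `gcd(p,q) = 1`, every mass admits a
`(q,p)`-spiral equicovering. -/
theorem spiral_equicovering_of_q_eq_three_p_sub_three (p q : ℕ) (hp : 3 ≤ p)
    (hodd : Odd p) (hq : q + 3 = 3 * p) (hcop : Nat.Coprime p q) :
    ∀ μ : Measure (ℝ × ℝ), IsMass μ → IsSpiralEquicovering μ q p := by
  intro μ hμ
  have := hμ.1
  obtain ⟨m, rfl⟩ := hodd
  obtain rfl : q = 6 * m := by omega
  have hm : 1 ≤ m := by omega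
  have hm' : (0 : ℝ) < m := by exact_mod_cast hm
  obtain ⟨O, θ, hper, hmono, hF, hle⟩ := hμ.exists_equipartition m (by exact_mod_cast hm)
  refine ⟨O, θ, fun j => ?_, fun j => hmono (by omega), fun i => ?_⟩
  · rw [← hper]
    push_cast
    rfl
  · have hcast : i + ((2 * m + 1 : ℕ) : ℤ) = i + (2 * (m : ℤ) + 1) := by push_cast; rfl
    rw [hcast]
    have h1 := hF i (2 * (m : ℤ) + 1)
    have hlt : θ i < θ (i + (2 * (m : ℤ) + 1)) := by
      refine lt_of_le_of_ne (hmono (by omega)) fun h => ?_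
      rw [← h] at h1
      have : (0 : ℝ) < ((2 * (m : ℤ) + 1 : ℤ) : ℝ) / (6 * ((m : ℤ) : ℝ)) := by
        push_cast
        positivity
      linarith
    have h2 : θ (i + (2 * (m : ℤ) + 1)) ≤ θ i + Real.pi := by linarith [hle i]
    rw [wedge_eq_sector O hlt h2]
    refine ⟨convex_sector _ _ _, ?_⟩
    rw [← ofReal_measureReal, ← radialCDF_sub hμ O hlt h2, h1]
    congr 1
    push_cast
    ring
end
end
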